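/- arXiv:1111.4989 — 4 statements merged into one kernel-verified Lean document; each statement's English description precedes it below -/
import Mathlib

section
/- Let T_x be a rooted tree and L = {L(v)} a list assignment with |L(v)| = k for every vertex v. Then the number D(T_x; L) of equivalence classes of distinguishing L-colorings of T_x satisfies D(T_x; L) ≥ D(T_x; k), where D(T_x; k) is the number of equivalence classes of distinguishing k-colorings. -/
open SimpleGraph

noncomputable section

def ecc {V : Type*} [Fintype V] (G : SimpleGraph V) (v : V) : ℕ :=
  Finset.univ.sup fun u => G.dist u v

def graphCenter {V : Type*} [Fintype V] (G : SimpleGraph V) : Set V :=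
  {v | ∀ u, ecc G v ≤ ecc G u}

def desc {V : Type*} (G : SimpleGraph V) (x v : V) : Set V :=
  {u | G.dist u x = G.dist u v + G.dist v x}

lemma self_mem_desc {V : Type*} (G : SimpleGraph V) (x v : V) : v ∈ desc G x v := by
  simp [desc]

def Distinguishes {V α : Type*} (G : SimpleGraph V) (r : V) (φ : V → α) : Prop :=
  ∀ σ : G ≃g G, σ r = r → (∀ w, φ (σ w) = φ w) → ∀ w, σ w = w

def DistinguishesU {V α : Type*} (G : SimpleGraph V) (φ : V → α) : Prop :=
  ∀ σ : G ≃g G, (∀ w, φ (σ w) = φ w) → ∀ w, σ w = w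

def RootedIso {V W : Type*} (G : SimpleGraph V) (H : SimpleGraph W) (r : V) (s : W) : Prop :=
  ∃ π : G ≃g H, π r = s

def ColEquiv {V W α : Type*} (G : SimpleGraph V) (H : SimpleGraph W) (r : V) (s : W)
    (φ : V → α) (ψ : W → α) : Prop :=
  ∃ π : G ≃g H, π r = s ∧ ∀ w, φ w = ψ (π w)

def IsProper {V α : Type*} (G : SimpleGraph V) (φ : V → α) : Prop :=
  ∀ a b, G.Adj a b → φ a ≠ φ b

def DCount {V : Type*} (G : SimpleGraph V) (r : V) (k : ℕ) : ℕ :=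
  Nat.card (Quot fun φ ψ : {f : V → Fin k // Distinguishes G r f} =>
    ∃ σ : G ≃g G, σ r = r ∧ ∀ w, φ.1 w = ψ.1 (σ w))

def DCountL {V : Type*} (G : SimpleGraph V) (r : V) (L : V → Finset ℕ) : ℕ :=
  Nat.card (Quot fun φ ψ : {f : V → ℕ // (∀ v, f v ∈ L v) ∧ Distinguishes G r f} =>
    ∃ σ : G ≃g G, σ r = r ∧ ∀ w, φ.1 w = ψ.1 (σ w))

def DChiCount {V : Type*} (G : SimpleGraph V) (r : V) (k : ℕ) : ℕ :=
  Nat.card (Quot fun φ ψ : {f : V → Fin k // IsProper G f ∧ Distinguishes G r f} =>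
    ∃ σ : G ≃g G, σ r = r ∧ ∀ w, φ.1 w = ψ.1 (σ w))

def DChiCountI {V : Type*} (G : SimpleGraph V) (r : V) (k : ℕ) (i : Fin k) : ℕ :=
  Nat.card (Quot fun φ ψ : {f : V → Fin k // IsProper G f ∧ Distinguishes G r f ∧ f r = i} =>
    ∃ σ : G ≃g G, σ r = r ∧ ∀ w, φ.1 w = ψ.1 (σ w))

def DChiCountLI {V : Type*} (G : SimpleGraph V) (r : V) (L : V → Finset ℕ) (i : ℕ) : ℕ :=
  Nat.card (Quot fun φ ψ : {f : V → ℕ // (∀ v, f v ∈ L v) ∧ IsProper G f ∧ Distinguishes G r f ∧ f r = i} =>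
    ∃ σ : G ≃g G, σ r = r ∧ ∀ w, φ.1 w = ψ.1 (σ w))

def DNum {V : Type*} (G : SimpleGraph V) (r : V) : ℕ :=
  sInf {k | ∃ φ : V → Fin k, Distinguishes G r φ}

def DListNum {V : Type*} (G : SimpleGraph V) (r : V) : ℕ :=
  sInf {k | ∀ L : V → Finset ℕ, (∀ v, (L v).card = k) →
    ∃ φ : V → ℕ, (∀ v, φ v ∈ L v) ∧ Distinguishes G r φ}

def DNumU {V : Type*} (G : SimpleGraph V) : ℕ :=
  sInf {k | ∃ φ : V → Fin k, DistinguishesU G φ}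

def DListNumU {V : Type*} (G : SimpleGraph V) : ℕ :=
  sInf {k | ∀ L : V → Finset ℕ, (∀ v, (L v).card = k) →
    ∃ φ : V → ℕ, (∀ v, φ v ∈ L v) ∧ DistinguishesU G φ}

def chiD {V : Type*} (G : SimpleGraph V) (r : V) : ℕ :=
  sInf {k | ∃ φ : V → Fin k, IsProper G φ ∧ Distinguishes G r φ}

def chiDL {V : Type*} (G : SimpleGraph V) (r : V) : ℕ :=
  sInf {k | ∀ L : V → Finset ℕ, (∀ v, (L v).card = k) →
    ∃ φ : V → ℕ, (∀ v, φ v ∈ L v) ∧ IsProper G φ ∧ Distinguishes G r φ}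

def chiDU {V : Type*} (G : SimpleGraph V) : ℕ :=
  sInf {k | ∃ φ : V → Fin k, IsProper G φ ∧ DistinguishesU G φ}

def chiDLU {V : Type*} (G : SimpleGraph V) : ℕ :=
  sInf {k | ∀ L : V → Finset ℕ, (∀ v, (L v).card = k) →
    ∃ φ : V → ℕ, (∀ v, φ v ∈ L v) ∧ IsProper G φ ∧ DistinguishesU G φ}

def subdiv {V : Type*} (G : SimpleGraph V) (u v : V) : SimpleGraph (V ⊕ Unit) :=
  SimpleGraph.fromRel fun a b =>
    match a, b with
    | Sum.inl a, Sum.inl b => G.Adj a b ∧ ¬(a = u ∧ b = v) ∧ ¬(a = v ∧ b = u)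
    | Sum.inl a, Sum.inr _ => a = u ∨ a = v
    | Sum.inr _, _ => False

def childOf {V : Type*} (G : SimpleGraph V) (r v u : V) : Prop :=
  G.Adj v u ∧ G.dist u r = G.dist v r + 1

def t6E (a : ℕ) (M : Multiset ℕ) : ℕ := Encodable.encode (a, M)

theorem t6E_inj {a b : ℕ} {M M' : Multiset ℕ} (h : t6E a M = t6E b M') : a = b ∧ M = M' := by
  have := Encodable.encode_injective h
  simpa using this

def t6code {V : Type*} (C : V → Finset V) (φ : V → ℕ) : ℕ → V → ℕ
  | 0, _ => 0
  | n+1, v => t6E (φ v) ((C v).val.map (t6code C φ n))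

def t6sh {V : Type*} (C : V → Finset V) : ℕ → V → ℕ
  | 0, _ => 0
  | n+1, v => Encodable.encode ((C v).val.map (t6sh C n))

def t6shC : ℕ → ℕ → ℕ
  | 0, _ => 0
  | n+1, s => match (Encodable.decode s : Option (ℕ × Multiset ℕ)) with
    | some q => Encodable.encode (q.2.map (t6shC n))
    | none => 0

theorem t6shC_E (n a : ℕ) (M : Multiset ℕ) :
    t6shC (n+1) (t6E a M) = Encodable.encode (M.map (t6shC n)) := by
  simp [t6shC, t6E]

open Classical in
def t6SDR {V : Type*} (S : V → Finset ℕ) (B : Finset V) : Finset (Finset ℕ) :=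
  (B.biUnion S).powerset.filter
    (fun X => ∃ f : V → ℕ, Set.InjOn f B ∧ (∀ u ∈ B, f u ∈ S u) ∧ X = B.image f)

theorem t6mem_SDR {V : Type*} (S : V → Finset ℕ) (B : Finset V) (X : Finset ℕ) :
    X ∈ t6SDR S B ↔ ∃ f : V → ℕ, Set.InjOn f B ∧ (∀ u ∈ B, f u ∈ S u) ∧ X = B.image f := by
  classical
  unfold t6SDR
  rw [Finset.mem_filter]
  constructor
  · exact fun h => h.2
  · rintro ⟨f, h1, h2, h3⟩
    refine ⟨?_, f, h1, h2, h3⟩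
    rw [Finset.mem_powerset, h3]
    intro y hy
    obtain ⟨u, hu, rfl⟩ := Finset.mem_image.1 hy
    exact Finset.mem_biUnion.2 ⟨u, hu, h2 u hu⟩

theorem t6SDR_card {V : Type*} (S : V → Finset ℕ) (B : Finset V) (X : Finset ℕ)
    (h : X ∈ t6SDR S B) : X.card = B.card := by
  obtain ⟨f, h1, h2, rfl⟩ := (t6mem_SDR S B X).1 h
  exact Finset.card_image_of_injOn h1

/-- extend by union of disjoint representatives -/
theorem t6SDR_union {V : Type*} [DecidableEq V] (S : V → Finset ℕ) (A B : Finset V) (X Y : Finset ℕ)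
    (hAB : Disjoint A B) (hX : X ∈ t6SDR S A) (hY : Y ∈ t6SDR S B) (hXY : Disjoint X Y) :
    X ∪ Y ∈ t6SDR S (A ∪ B) := by
  obtain ⟨f, f1, f2, rfl⟩ := (t6mem_SDR S A X).1 hX
  obtain ⟨g, g1, g2, rfl⟩ := (t6mem_SDR S B Y).1 hY
  rw [t6mem_SDR]
  have hB : ∀ u ∈ B, u ∉ A := fun u hu hA => Finset.disjoint_left.1 hAB hA hu
  have hne : ∀ u ∈ A, ∀ w ∈ B, f u ≠ g w := by
    intro u hu w hw h
    exact Finset.disjoint_left.1 hXY (Finset.mem_image_of_mem f hu)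
      (h ▸ Finset.mem_image_of_mem g hw)
  refine ⟨fun u => if u ∈ A then f u else g u, ?_, ?_, ?_⟩
  · intro u hu w hw h
    simp only [Finset.coe_union, Set.mem_union, Finset.mem_coe] at hu hw
    dsimp only at h
    rcases hu with hu | hu <;> rcases hw with hw | hw
    · rw [if_pos hu, if_pos hw] at h; exact f1 hu hw h
    · rw [if_pos hu, if_neg (hB w hw)] at h; exact absurd h (hne u hu w hw)
    · rw [if_neg (hB u hu), if_pos hw] at h; exact absurd h.symm (hne w hw u hu)
    · rw [if_neg (hB u hu), if_neg (hB w hw)] at h; exact g1 hu hw h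
  · intro u hu
    rcases Finset.mem_union.1 hu with hu | hu
    · simpa [hu] using f2 u hu
    · simpa [hB u hu] using g2 u hu
  · rw [Finset.image_union]
    congr 1
    · exact Finset.image_congr (fun u hu => by simp at hu; simp [hu])
    · exact Finset.image_congr (fun u hu => by simp at hu; simp [hB u hu])

theorem t6SDR_empty {V : Type*} (S : V → Finset ℕ) : (t6SDR S ∅).card = 1 := by
  have : t6SDR S ∅ = {∅} := by
    ext X; rw [t6mem_SDR]; simp
  rw [this]; rfl

theorem t6SDR_lower {V : Type*} (S : V → Finset ℕ) (d : ℕ) (B : Finset V) :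
    (∀ u ∈ B, d ≤ (S u).card) → d.choose B.card ≤ (t6SDR S B).card := by
  classical
  induction B using Finset.induction_on with
  | empty => intro _; rw [t6SDR_empty]; simp
  | insert b B hb ih =>
    intro hS
    have ih := ih (fun u hu => hS u (Finset.mem_insert_of_mem hu))
    rw [Finset.card_insert_of_notMem hb]
    have key : (t6SDR S B).card * (d - B.card) ≤ (t6SDR S (insert b B)).card * (B.card + 1) := by
      apply Finset.card_mul_le_card_mul (fun X Y => X ⊆ Y)
      · intro X hX
        have hXc := t6SDR_card S B X hX
        have h1 : d - B.card ≤ (S b \ X).card := by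
          have := Finset.le_card_sdiff X (S b)
          have := hS b (Finset.mem_insert_self _ _)
          omega
        refine h1.trans ?_
        apply Finset.card_le_card_of_injOn (fun y => insert y X)
        · intro y hy
          simp only [Finset.mem_coe, Finset.mem_sdiff] at hy
          simp only [Finset.mem_coe, Finset.mem_bipartiteAbove]
          refine ⟨?_, Finset.subset_insert _ _⟩
          have h2 : ({y} : Finset ℕ) ∈ t6SDR S {b} := by
            rw [t6mem_SDR]
            exact ⟨fun _ => y, by simp, by simp [hy.1], by simp⟩
          have := t6SDR_union S {b} B {y} X (by simpa using hb) h2 hX (by simpa using hy.2)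
          rwa [← Finset.insert_eq, ← Finset.insert_eq] at this
        · intro y hy z hz h
          simp only [Finset.mem_coe, Finset.mem_sdiff] at hy hz
          have : y ∈ insert z X := by
            rw [← show insert y X = insert z X from h]; exact Finset.mem_insert_self _ _
          rcases Finset.mem_insert.1 this with h | h
          · exact h
          · exact absurd h hy.2
      · intro Y hY
        have hYc := t6SDR_card S _ Y hY
        rw [Finset.card_insert_of_notMem hb] at hYc
        have : Finset.bipartiteBelow (fun X Y => X ⊆ Y) (t6SDR S B) Y ⊆ Finset.powersetCard B.card Y := by
          intro X hX
          simp only [Finset.mem_bipartiteBelow] at hX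
          exact Finset.mem_powersetCard.2 ⟨hX.2, t6SDR_card S B X hX.1⟩
        refine (Finset.card_le_card this).trans ?_
        rw [Finset.card_powersetCard, hYc]; simp
    have h3 := Nat.choose_succ_right_eq d B.card
    have h4 := Nat.mul_le_mul_right (d - B.card) ih
    exact Nat.le_of_mul_le_mul_right (h3.le.trans (h4.trans key)) (Nat.succ_pos _)

theorem t6SDR_typed {V : Type*} (S : V → Finset ℕ) (τ : V → ℕ) (q : ℕ → ℕ) (d : ℕ → ℕ)
    (C : Finset V) (hq : ∀ u ∈ C, ∀ s ∈ S u, q s = τ u) (hd : ∀ u ∈ C, d (τ u) ≤ (S u).card)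
    (T : Finset ℕ) :
    ∏ t ∈ T, (d t).choose (C.filter (fun u => τ u = t)).card
      ≤ (t6SDR S (C.filter (fun u => τ u ∈ T))).card := by
  classical
  induction T using Finset.induction_on with
  | empty => simp [t6SDR_empty]
  | insert t T ht ih =>
    rw [Finset.prod_insert ht]
    have h1 := t6SDR_lower S (d t) (C.filter (fun u => τ u = t)) (by
      intro u hu
      rw [Finset.mem_filter] at hu
      exact hu.2 ▸ hd u hu.1)
    refine (Nat.mul_le_mul h1 ih).trans ?_
    rw [← Finset.card_product]
    have hun : C.filter (fun u => τ u ∈ insert t T)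
      = C.filter (fun u => τ u = t) ∪ C.filter (fun u => τ u ∈ T) := by
      ext u; simp only [Finset.mem_filter, Finset.mem_insert, Finset.mem_union]; tauto
    rw [hun]
    have hX : ∀ X ∈ t6SDR S (C.filter (fun u => τ u = t)), ∀ s ∈ X, q s = t := by
      intro X hX s hs
      obtain ⟨f, f1, f2, rfl⟩ := (t6mem_SDR S _ X).1 hX
      obtain ⟨u, hu, rfl⟩ := Finset.mem_image.1 hs
      have := f2 u hu
      rw [Finset.mem_filter] at hu
      rw [hq u hu.1 _ this, hu.2]
    have hY : ∀ X ∈ t6SDR S (C.filter (fun u => τ u ∈ T)), ∀ s ∈ X, q s ∈ T := by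
      intro X hX s hs
      obtain ⟨f, f1, f2, rfl⟩ := (t6mem_SDR S _ X).1 hX
      obtain ⟨u, hu, rfl⟩ := Finset.mem_image.1 hs
      have := f2 u hu
      rw [Finset.mem_filter] at hu
      rw [hq u hu.1 _ this]; exact hu.2
    apply Finset.card_le_card_of_injOn (fun z => z.1 ∪ z.2)
    · rintro ⟨X, Y⟩ hz
      simp only [Finset.coe_product, Set.mem_prod, Finset.mem_coe] at hz
      apply t6SDR_union S _ _ X Y _ hz.1 hz.2
      · rw [Finset.disjoint_left]
        intro s h1 h2
        exact ht (hX X hz.1 s h1 ▸ hY Y hz.2 s h2)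
      · rw [Finset.disjoint_left]
        intro s h1 h2
        rw [Finset.mem_filter] at h1 h2
        exact ht (h1.2 ▸ h2.2)
    · rintro ⟨X, Y⟩ hz ⟨X', Y'⟩ hz' h
      simp only [Finset.coe_product, Set.mem_prod, Finset.mem_coe] at hz hz' h
      have e1 : ∀ X Y, X ∈ t6SDR S (C.filter (fun u => τ u = t)) →
          Y ∈ t6SDR S (C.filter (fun u => τ u ∈ T)) →
          X = (X ∪ Y).filter (fun s => q s = t) ∧ Y = (X ∪ Y).filter (fun s => q s ≠ t) := by
        intro X Y h1 h2
        constructor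
        · ext s
          simp only [Finset.mem_filter, Finset.mem_union]
          constructor
          · intro h; exact ⟨Or.inl h, hX X h1 s h⟩
          · rintro ⟨h | h, h'⟩
            · exact h
            · exact absurd (h' ▸ hY Y h2 s h) ht
        · ext s
          simp only [Finset.mem_filter, Finset.mem_union]
          constructor
          · intro h; exact ⟨Or.inr h, fun h' => ht (h' ▸ hY Y h2 s h)⟩
          · rintro ⟨h | h, h'⟩
            · exact absurd (hX X h1 s h) h'
            · exact h
      have a1 := e1 X Y hz.1 hz.2
      have a2 := e1 X' Y' hz'.1 hz'.2
      rw [h] at a1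
      exact Prod.ext (a1.1.trans a2.1.symm) (a1.2.trans a2.2.symm)

def t6SS {V : Type*} (C : V → Finset V) (L : V → Finset ℕ) : ℕ → V → Finset ℕ
  | 0, _ => {0}
  | n+1, v => (L v ×ˢ t6SDR (t6SS C L n) (C v)).image fun q => t6E q.1 q.2.val

theorem t6mem_SS {V : Type*} (C : V → Finset V) (L : V → Finset ℕ) (n : ℕ) (v : V) (s : ℕ) :
    s ∈ t6SS C L (n+1) v ↔ ∃ a ∈ L v, ∃ f : V → ℕ, Set.InjOn f (C v) ∧
      (∀ u ∈ C v, f u ∈ t6SS C L n u) ∧ s = t6E a ((C v).val.map f) := by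
  simp only [t6SS, Finset.mem_image, Finset.mem_product, Prod.exists, t6mem_SDR]
  constructor
  · rintro ⟨a, X, ⟨ha, f, f1, f2, rfl⟩, rfl⟩
    exact ⟨a, ha, f, f1, f2, by rw [Finset.image_val_of_injOn f1]⟩
  · rintro ⟨a, ha, f, f1, f2, rfl⟩
    exact ⟨a, _, ⟨ha, f, f1, f2, rfl⟩, by rw [Finset.image_val_of_injOn f1]⟩

theorem t6SS_card {V : Type*} (C : V → Finset V) (L : V → Finset ℕ) (n : ℕ) (v : V) :
    (t6SS C L (n+1) v).card = (L v).card * (t6SDR (t6SS C L n) (C v)).card := by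
  rw [t6SS, Finset.card_image_of_injective, Finset.card_product]
  rintro ⟨a, X⟩ ⟨b, Y⟩ h
  have := t6E_inj h
  exact Prod.ext this.1 (Finset.val_injective this.2)

theorem t6SS_shape {V : Type*} (C : V → Finset V) (L : V → Finset ℕ) (n : ℕ) :
    ∀ (v : V), ∀ s ∈ t6SS C L n v, t6shC n s = t6sh C n v := by
  induction n with
  | zero => intro v s _; rfl
  | succ n ih =>
    intro v s hs
    obtain ⟨a, ha, f, f1, f2, rfl⟩ := (t6mem_SS C L n v s).1 hs
    rw [t6shC_E, t6sh, Multiset.map_map]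
    congr 1
    exact Multiset.map_congr rfl (fun u hu => ih u _ (f2 u hu))

def t6AA {V : Type*} [Fintype V] (C : V → Finset V) (k n t : ℕ) : Finset ℕ :=
  (Finset.univ.filter (fun v => t6sh C n v = t)).biUnion (t6SS C (fun _ => Finset.range k) n)

theorem t6mem_AA {V : Type*} [Fintype V] (C : V → Finset V) (k n t s : ℕ) :
    s ∈ t6AA C k n t ↔ ∃ v, t6sh C n v = t ∧ s ∈ t6SS C (fun _ => Finset.range k) n v := by
  simp [t6AA]

theorem t6AA_upper {V : Type*} [Fintype V] (C : V → Finset V) (k n : ℕ) (v : V) :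
    (t6AA C k (n+1) (t6sh C (n+1) v)).card ≤ k * ∏ t ∈ (C v).image (t6sh C n),
      (t6AA C k n t).card.choose ((C v).filter (fun u => t6sh C n u = t)).card := by
  classical
  set T := (C v).image (t6sh C n) with hT
  set P := T.pi (fun t => Finset.powersetCard ((C v).filter (fun u => t6sh C n u = t)).card
    (t6AA C k n t)) with hP
  have hc : k * ∏ t ∈ T, (t6AA C k n t).card.choose ((C v).filter (fun u => t6sh C n u = t)).card
      = (Finset.range k ×ˢ P).card := by
    rw [Finset.card_product, Finset.card_pi, Finset.card_range]
    simp only [Finset.card_powersetCard]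
  rw [hc]
  refine le_trans (Finset.card_le_card (t := (Finset.range k ×ˢ P).image
    (fun z => t6E z.1 (T.attach.biUnion (fun t => z.2 t.1 t.2)).val)) ?_) Finset.card_image_le
  intro s hs
  obtain ⟨u, hu, hs⟩ := (t6mem_AA C k (n+1) _ s).1 hs
  obtain ⟨a, ha, f, f1, f2, rfl⟩ := (t6mem_SS _ _ n u s).1 hs
  have hm : (C u).val.map (t6sh C n) = (C v).val.map (t6sh C n) := Encodable.encode_injective hu
  have hcount : ∀ t, ((C u).filter (fun w => t6sh C n w = t)).card
      = ((C v).filter (fun w => t6sh C n w = t)).card := by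
    intro t
    have := congrArg (Multiset.count t) hm
    rw [Multiset.count_map, Multiset.count_map] at this
    simpa [Finset.card, Finset.filter_val, eq_comm] using this
  have hq : ∀ w ∈ C u, t6shC n (f w) = t6sh C n w := fun w hw => t6SS_shape C _ n w _ (f2 w hw)
  rw [Finset.mem_image]
  refine ⟨(a, fun t _ => ((C u).filter (fun w => t6sh C n w = t)).image f), ?_, ?_⟩
  · rw [Finset.mem_product]
    refine ⟨ha, ?_⟩
    rw [hP, Finset.mem_pi]
    intro t _
    rw [Finset.mem_powersetCard]
    constructor
    · intro y hy
      obtain ⟨w, hw, rfl⟩ := Finset.mem_image.1 hy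
      rw [Finset.mem_filter] at hw
      exact (t6mem_AA C k n t _).2 ⟨w, hw.2, f2 w hw.1⟩
    · rw [← hcount]
      exact Finset.card_image_of_injOn (f1.mono (by intro w hw; simp at hw; exact hw.1))
  · dsimp only
    rw [← Finset.image_val_of_injOn f1]
    congr 2
    ext y
    simp only [Finset.mem_biUnion, Finset.mem_attach, true_and, Finset.mem_image,
      Finset.mem_filter, Subtype.exists]
    constructor
    · rintro ⟨t, ht, w, ⟨hw, _⟩, rfl⟩; exact ⟨w, hw, rfl⟩
    · rintro ⟨w, hw, rfl⟩
      refine ⟨t6sh C n w, ?_, w, ⟨hw, rfl⟩, rfl⟩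
      have : t6sh C n w ∈ (C v).val.map (t6sh C n) := by
        rw [← hm]; exact Multiset.mem_map_of_mem _ hw
      obtain ⟨w', h1, h2⟩ := Multiset.mem_map.1 this
      exact Finset.mem_image.2 ⟨w', h1, h2⟩

theorem t6count {V : Type*} [Fintype V] (C : V → Finset V) (k : ℕ) (L : V → Finset ℕ)
    (hL : ∀ v, (L v).card = k) (n : ℕ) :
    ∀ v, (t6AA C k n (t6sh C n v)).card ≤ (t6SS C L n v).card := by
  induction n with
  | zero =>
    intro v
    apply Finset.card_le_card
    intro s hs
    obtain ⟨u, _, hs⟩ := (t6mem_AA C k 0 _ s).1 hs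
    exact hs
  | succ n ih =>
    intro v
    refine (t6AA_upper C k n v).trans ?_
    rw [t6SS_card, hL]
    apply Nat.mul_le_mul_left
    have := t6SDR_typed (t6SS C L n) (t6sh C n) (t6shC n) (fun t => (t6AA C k n t).card) (C v)
      (fun u _ s hs => t6SS_shape C L n u s hs) (fun u _ => ih u) ((C v).image (t6sh C n))
    refine this.trans (le_of_eq ?_)
    congr 2
    apply Finset.filter_true_of_mem
    intro u hu
    exact Finset.mem_image_of_mem _ hu

theorem t6match {V : Type*} (f g : V → ℕ) (A : Finset V) :
    ∀ B : Finset V, A.val.map f = B.val.map g →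
    ∃ β : V → V, Set.InjOn β A ∧ ∀ w ∈ A, β w ∈ B ∧ g (β w) = f w := by
  classical
  induction A using Finset.induction_on with
  | empty => intro B _; exact ⟨id, by simp, by simp⟩
  | insert a A ha ih =>
    intro B h
    rw [Finset.insert_val_of_notMem ha, Multiset.map_cons] at h
    have hm : f a ∈ B.val.map g := by rw [← h]; exact Multiset.mem_cons_self _ _
    obtain ⟨b, hb, hgb⟩ := Multiset.mem_map.1 hm
    have hb' : b ∈ B := hb
    have hB : B.val = b ::ₘ (B.erase b).val := by
      rw [← Finset.insert_val_of_notMem (Finset.notMem_erase b B), Finset.insert_erase hb']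
    rw [hB, Multiset.map_cons, hgb, Multiset.cons_inj_right] at h
    obtain ⟨β, h1, h2⟩ := ih _ h
    have hne : ∀ w ∈ A, w ≠ a := fun w hw e => ha (e ▸ hw)
    refine ⟨Function.update β a b, ?_, ?_⟩
    · intro u hu w hw e
      simp only [Finset.coe_insert, Set.mem_insert_iff, Finset.mem_coe] at hu hw
      rcases hu with rfl | hu <;> rcases hw with rfl | hw
      · rfl
      · rw [Function.update_self, Function.update_of_ne (hne w hw)] at e
        exact absurd e.symm (Finset.ne_of_mem_erase (h2 w hw).1)
      · rw [Function.update_self, Function.update_of_ne (hne u hu)] at e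
        exact absurd e (Finset.ne_of_mem_erase (h2 u hu).1)
      · rw [Function.update_of_ne (hne w hw), Function.update_of_ne (hne u hu)] at e
        exact h1 hu hw e
    · intro w hw
      rcases Finset.mem_insert.1 hw with rfl | hw
      · rw [Function.update_self]; exact ⟨hb', hgb⟩
      · rw [Function.update_of_ne (hne w hw)]
        exact ⟨Finset.mem_of_mem_erase (h2 w hw).1, (h2 w hw).2⟩

theorem t6topdown {V β : Type*} (x : V) (p : V → V) (d : V → ℕ) (d0 : d x = 0)
    (hp : ∀ w, w ≠ x → d w = d (p w) + 1) (b0 : β) (step : V → β → β) :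
    ∃ F : V → β, F x = b0 ∧ ∀ w, w ≠ x → F w = step w (F (p w)) := by
  let H : ℕ → V → β := fun n => Nat.rec (fun _ => b0) (fun _ h w => step w (h (p w))) n
  refine ⟨fun w => H (d w) w, ?_, ?_⟩
  · simp only [d0]; rfl
  · intro w hw
    simp only [hp w hw]; rfl

open Classical in
def t6C {V : Type*} [Fintype V] (x : V) (p : V → V) (v : V) : Finset V :=
  Finset.univ.filter (fun w => w ≠ x ∧ p w = v)

theorem t6mem_C {V : Type*} [Fintype V] (x : V) (p : V → V) (v w : V) :
    w ∈ t6C x p v ↔ w ≠ x ∧ p w = v := by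
  simp [t6C]

def t6c {V : Type*} [Fintype V] (x : V) (p : V → V) (d : V → ℕ) (N : ℕ) (φ : V → ℕ) (w : V) : ℕ :=
  t6code (t6C x p) φ (N - d w) w

section
variable {V : Type*} [Fintype V] {x : V} {p : V → V} {d : V → ℕ} {N : ℕ}

theorem t6c_eq (hp : ∀ w, w ≠ x → d w = d (p w) + 1) (hN : ∀ w, d w < N)
    (φ : V → ℕ) (w : V) :
    t6c x p d N φ w = t6E (φ w) ((t6C x p w).val.map (t6c x p d N φ)) := by
  unfold t6c
  obtain ⟨n, hn⟩ : ∃ n, N - d w = n + 1 := ⟨N - d w - 1, by have := hN w; omega⟩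
  rw [hn, t6code]
  congr 1
  apply Multiset.map_congr rfl
  intro u hu
  have hu := (t6mem_C x p w u).1 hu
  have := hp u hu.1
  rw [hu.2] at this
  rw [show N - d u = n by omega]

theorem t6depth_ind (hp : ∀ w, w ≠ x → d w = d (p w) + 1) (P : V → Prop) (h0 : P x)
    (hs : ∀ w, w ≠ x → P (p w) → P w) (w : V) : P w := by
  induction h : d w generalizing w with
  | zero =>
    by_cases hw : w = x
    · exact hw ▸ h0
    · have := hp w hw; omega
  | succ n ih =>
    by_cases hw : w = x
    · exact hw ▸ h0
    · have := hp w hw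
      exact hs w hw (ih (p w) (by omega))

/-- the colorings realizing a code -/
theorem t6realize (d0 : d x = 0) (hp : ∀ w, w ≠ x → d w = d (p w) + 1) (hN : ∀ w, d w < N)
    (L : V → Finset ℕ) (s : ℕ) (hs : s ∈ t6SS (t6C x p) L N x) :
    ∃ φ : V → ℕ, (∀ v, φ v ∈ L v) ∧ t6c x p d N φ x = s ∧
      ∀ v, Set.InjOn (t6c x p d N φ) (t6C x p v) := by
  classical
  have hex : ∀ v s, ∃ (a : ℕ) (f : V → ℕ), s ∈ t6SS (t6C x p) L (N - d v) v →
      a ∈ L v ∧ Set.InjOn f (t6C x p v) ∧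
      (∀ u ∈ t6C x p v, f u ∈ t6SS (t6C x p) L (N - d u) u) ∧
        s = t6E a ((t6C x p v).val.map f) := by
    intro v s
    by_cases h : s ∈ t6SS (t6C x p) L (N - d v) v
    · obtain ⟨n, hn⟩ : ∃ n, N - d v = n + 1 := ⟨N - d v - 1, by have := hN v; omega⟩
      have h' := h
      rw [hn] at h'
      obtain ⟨a, ha, f, f1, f2, f3⟩ := (t6mem_SS _ _ _ _ _).1 h'
      refine ⟨a, f, fun _ => ⟨ha, f1, ?_, f3⟩⟩
      intro u hu
      have hu' := (t6mem_C x p v u).1 hu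
      have := hp u hu'.1
      rw [hu'.2] at this
      rw [show N - d u = n by omega]
      exact f2 u hu
    · exact ⟨0, fun _ => 0, fun h' => absurd h' h⟩
  choose a f hf using hex
  obtain ⟨l, l0, l1⟩ := t6topdown x p d d0 hp s (fun w s' => f (p w) s' w)
  have hl : ∀ w, l w ∈ t6SS (t6C x p) L (N - d w) w := by
    apply t6depth_ind hp
    · rw [l0, d0]; exact hs
    · intro w hw ih
      rw [l1 w hw]
      exact (hf (p w) _ ih).2.2.1 w ((t6mem_C x p _ _).2 ⟨hw, rfl⟩)
  have hl' : ∀ v, ∀ u ∈ t6C x p v, l u = f v (l v) u := by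
    intro v u hu
    have hu' := (t6mem_C x p v u).1 hu
    rw [l1 u hu'.1, hu'.2]
  have hc : ∀ m w, N - d w = m → t6c x p d N (fun v => a v (l v)) w = l w := by
    intro m
    induction m with
    | zero => intro w hw; have := hN w; omega
    | succ m ih =>
      intro w hw
      rw [t6c_eq hp hN]
      have he : Multiset.map (t6c x p d N fun v => a v (l v)) (t6C x p w).val
          = Multiset.map (f w (l w)) (t6C x p w).val := by
        apply Multiset.map_congr rfl
        intro u hu
        have hu' := (t6mem_C x p w u).1 hu
        have := hp u hu'.1
        rw [hu'.2] at this
        rw [ih u (by omega), hl' w u hu]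
      rw [he]
      exact (hf w _ (hl w)).2.2.2.symm
  refine ⟨fun v => a v (l v), fun v => (hf v _ (hl v)).1, by rw [hc _ x rfl, l0], ?_⟩
  intro v u hu w hw h
  rw [hc _ u rfl, hc _ w rfl, hl' v u hu, hl' v w hw] at h
  exact (hf v _ (hl v)).2.1 hu hw h

/-- good colorings have code in the code set -/
theorem t6code_mem (hp : ∀ w, w ≠ x → d w = d (p w) + 1) (hN : ∀ w, d w < N)
    (L : V → Finset ℕ) (φ : V → ℕ) (hφ : ∀ v, φ v ∈ L v)
    (hg : ∀ v, Set.InjOn (t6c x p d N φ) (t6C x p v)) :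
    ∀ m w, N - d w = m → t6c x p d N φ w ∈ t6SS (t6C x p) L m w := by
  intro m
  induction m with
  | zero => intro w hw; have := hN w; omega
  | succ m ih =>
    intro w hw
    rw [t6mem_SS]
    refine ⟨φ w, hφ w, t6c x p d N φ, hg w, ?_, t6c_eq hp hN φ w⟩
    intro u hu
    have hu' := (t6mem_C x p w u).1 hu
    have := hp u hu'.1
    rw [hu'.2] at this
    exact ih u (by omega)

def t6Valid (x : V) (p : V → V) (d : V → ℕ) (N : ℕ) (φ ψ : V → ℕ) (β : V → V → V → V) : Prop :=
  ∀ a b, t6c x p d N φ a = t6c x p d N ψ b →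
    Set.InjOn (β a b) (t6C x p a) ∧
    ∀ w ∈ t6C x p a, β a b w ∈ t6C x p b ∧ t6c x p d N ψ (β a b w) = t6c x p d N φ w

theorem t6valid_exists (hp : ∀ w, w ≠ x → d w = d (p w) + 1) (hN : ∀ w, d w < N)
    (φ ψ : V → ℕ) : ∃ β, t6Valid x p d N φ ψ β := by
  have : ∀ a b, ∃ β : V → V, t6c x p d N φ a = t6c x p d N ψ b →
    Set.InjOn β (t6C x p a) ∧
    ∀ w ∈ t6C x p a, β w ∈ t6C x p b ∧ t6c x p d N ψ (β w) = t6c x p d N φ w := by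
    intro a b
    by_cases h : t6c x p d N φ a = t6c x p d N ψ b
    · have h' := h
      rw [t6c_eq hp hN, t6c_eq hp hN] at h'
      obtain ⟨β, hβ⟩ := t6match _ _ _ _ (t6E_inj h').2
      exact ⟨β, fun _ => hβ⟩
    · exact ⟨id, fun h' => absurd h' h⟩
  choose β hβ using this
  exact ⟨β, hβ⟩

theorem t6iso (G : SimpleGraph V) (d0 : d x = 0) (hp : ∀ w, w ≠ x → d w = d (p w) + 1)
    (hN : ∀ w, d w < N)
    (hG : ∀ a b, G.Adj a b ↔ (b ≠ x ∧ p b = a) ∨ (a ≠ x ∧ p a = b))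
    (φ ψ : V → ℕ) (h : t6c x p d N φ x = t6c x p d N ψ x) (β : V → V → V → V)
    (hβ : t6Valid x p d N φ ψ β) :
    ∃ σ : G ≃g G, σ x = x ∧ (∀ w, φ w = ψ (σ w)) ∧
      ∀ w, w ≠ x → σ w = β (p w) (σ (p w)) w := by
  obtain ⟨g, g0, g1⟩ := t6topdown x p d d0 hp x (fun w y => β (p w) y w)
  have hc : ∀ w, t6c x p d N φ w = t6c x p d N ψ (g w) := by
    apply t6depth_ind hp
    · rw [g0]; exact h
    · intro w hw ih
      rw [g1 w hw]
      exact ((hβ _ _ ih).2 w ((t6mem_C x p _ _).2 ⟨hw, rfl⟩)).2.symm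
  have hgC : ∀ w, w ≠ x → g w ≠ x ∧ p (g w) = g (p w) := by
    intro w hw
    have := ((hβ _ _ (hc (p w))).2 w ((t6mem_C x p _ _).2 ⟨hw, rfl⟩)).1
    rw [← g1 w hw] at this
    exact (t6mem_C x p _ _).1 this
  have hinj : ∀ w w', g w = g w' → w = w' := by
    apply t6depth_ind hp (fun w => ∀ w', g w = g w' → w = w')
    · intro w' hw'
      by_contra hne
      exact (hgC w' (Ne.symm hne)).1 (by rw [← hw', g0])
    · intro w hw ih w' hw'
      by_cases hx : w' = x
      · exact absurd (by rw [hw', hx, g0]) (hgC w hw).1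
      · have e : p w = p w' := by
          apply ih
          rw [← (hgC w hw).2, ← (hgC w' hx).2, hw']
        apply (hβ _ _ (hc (p w))).1 ((t6mem_C x p _ _).2 ⟨hw, rfl⟩)
          ((t6mem_C x p _ _).2 ⟨hx, e.symm⟩)
        rw [← g1 w hw, e, ← g1 w' hx, hw']
  have hbij : Function.Bijective g := Finite.injective_iff_bijective.1 (fun a b => hinj a b)
  have hxx : ∀ b, g b ≠ x ↔ b ≠ x := by
    intro b
    constructor
    · rintro h rfl; exact h g0
    · exact fun h => (hgC b h).1
  refine ⟨⟨Equiv.ofBijective g hbij, ?_⟩, g0, ?_, g1⟩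
  · intro a b
    simp only [Equiv.ofBijective_apply]
    have key : ∀ a b, (g b ≠ x ∧ p (g b) = g a) ↔ (b ≠ x ∧ p b = a) := by
      intro a b
      rw [hxx]
      apply and_congr_right
      intro hb
      rw [(hgC b hb).2]
      exact ⟨fun h => hinj _ _ h, fun h => h ▸ rfl⟩
    rw [hG, hG, key, key]
  · intro w
    have := hc w
    rw [t6c_eq hp hN, t6c_eq hp hN] at this
    exact (t6E_inj this).1

theorem t6good (G : SimpleGraph V) (d0 : d x = 0) (hp : ∀ w, w ≠ x → d w = d (p w) + 1)
    (hN : ∀ w, d w < N)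
    (hG : ∀ a b, G.Adj a b ↔ (b ≠ x ∧ p b = a) ∨ (a ≠ x ∧ p a = b))
    (φ : V → ℕ) (hD : Distinguishes G x φ) :
    ∀ v, Set.InjOn (t6c x p d N φ) (t6C x p v) := by
  classical
  intro v u hu u' hu' h
  by_contra hne
  have fixed : ∀ β, t6Valid x p d N φ φ β → ∀ w ∈ t6C x p v, β v v w = w := by
    intro β hβ w hw
    obtain ⟨σ, s0, s1, s2⟩ := t6iso G d0 hp hN hG φ φ rfl β hβ
    have hid := hD σ s0 (fun w => (s1 w).symm)
    have hw := (t6mem_C x p v w).1 hw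
    have := s2 w hw.1
    rw [hid, hid, hw.2] at this
    exact this.symm
  obtain ⟨β, hβ⟩ := t6valid_exists hp hN φ φ
  have hβ' : t6Valid x p d N φ φ
      (fun a b w => if a = v ∧ b = v then Equiv.swap u u' (β a b w) else β a b w) := by
    intro a b hab
    obtain ⟨h1, h2⟩ := hβ a b hab
    by_cases hv : a = v ∧ b = v
    · simp only [hv, and_self, if_true]
      obtain ⟨rfl, rfl⟩ := hv
      constructor
      · intro w hw w' hw' e
        exact h1 hw hw' ((Equiv.swap u u').injective e)
      · intro w hw
        obtain ⟨h3, h4⟩ := h2 w hw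
        rw [← h4]
        rw [Equiv.swap_apply_def]
        split_ifs with e1 e2
        · exact ⟨hu', by rw [e1]; exact h.symm⟩
        · exact ⟨hu, by rw [e2]; exact h⟩
        · exact ⟨h3, rfl⟩
    · simp only [hv, if_false]
      exact ⟨h1, h2⟩
  have e1 := fixed β hβ u hu
  have e2 := fixed _ hβ' u hu
  simp only [and_self, if_true] at e2
  rw [e1, Equiv.swap_apply_left] at e2
  exact hne e2.symm

theorem t6code_inv (σ : V ≃ V) (hx : σ x = x) (hσp : ∀ w, w ≠ x → p (σ w) = σ (p w))
    (φ ψ : V → ℕ) (h : ∀ w, φ w = ψ (σ w)) (n : ℕ) :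
    ∀ w, t6code (t6C x p) φ n w = t6code (t6C x p) ψ n (σ w) := by
  induction n with
  | zero => intro w; rfl
  | succ n ih =>
    intro w
    have hC : t6C x p (σ w) = (t6C x p w).map σ.toEmbedding := by
      ext y
      obtain ⟨z, rfl⟩ := σ.surjective y
      have : σ z ∈ (t6C x p w).map σ.toEmbedding ↔ z ∈ t6C x p w :=
        Finset.mem_map' σ.toEmbedding
      rw [this, t6mem_C, t6mem_C]
      have hz : σ z ≠ x ↔ z ≠ x := by
        rw [Ne, Ne, not_iff_not]
        constructor
        · intro h; exact σ.injective (h.trans hx.symm)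
        · rintro rfl; exact hx
      rw [hz]
      apply and_congr_right
      intro hz
      rw [hσp z hz]
      exact σ.injective.eq_iff
    rw [t6code, t6code, h w, hC, Finset.map_val, Multiset.map_map]
    congr 1
    exact Multiset.map_congr rfl (fun u _ => ih u)

theorem t6dist (G : SimpleGraph V) (hp : ∀ w, w ≠ x → d w = d (p w) + 1)
    (hσp : ∀ σ : G ≃g G, σ x = x → (∀ w, d (σ w) = d w) ∧ ∀ w, w ≠ x → p (σ w) = σ (p w))
    (φ : V → ℕ) (hg : ∀ v, Set.InjOn (t6c x p d N φ) (t6C x p v)) : Distinguishes G x φ := by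
  intro σ hx hc
  have hinv : ∀ w, t6c x p d N φ w = t6c x p d N φ (σ w) := by
    intro w
    unfold t6c
    rw [(hσp σ hx).1]
    exact t6code_inv σ.toEquiv hx (hσp σ hx).2 φ φ (fun w => (hc w).symm) _ w
  apply t6depth_ind hp
  · exact hx
  · intro w hw ih
    have h1 := (hσp σ hx).2 w hw
    rw [ih] at h1
    refine hg (p w) ((t6mem_C x p _ _).2 ⟨?_, h1⟩) ((t6mem_C x p _ _).2 ⟨hw, rfl⟩) (hinv w).symm
    intro h
    exact hw (σ.injective (h.trans hx.symm))
end

theorem t6parent {V : Type*} (G : SimpleGraph V) (hG : G.IsTree) (x : V) :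
    ∃ p : V → V, ∀ w, w ≠ x → G.Adj (p w) w ∧ G.dist x w = G.dist x (p w) + 1 ∧
      ∀ w', G.Adj w' w → G.dist x w = G.dist x w' + 1 → w' = p w := by
  have : ∀ w, ∃ y, w ≠ x → G.Adj y w ∧ G.dist x w = G.dist x y + 1 ∧
      ∀ w', G.Adj w' w → G.dist x w = G.dist x w' + 1 → w' = y := by
    intro w
    by_cases hw : w = x
    · exact ⟨x, fun h => absurd hw h⟩
    obtain ⟨q, hq, hql⟩ := hG.connected.exists_path_of_dist x w
    have hnil : ¬ q.Nil := by
      intro h; exact hw h.eq.symm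
    have hadj := q.adj_penultimate hnil
    have huniq : ∀ w', G.Adj w' w → G.dist x w = G.dist x w' + 1 → w' = q.penultimate := by
      intro w' ha hd
      obtain ⟨r, hr, hrl⟩ := hG.connected.exists_path_of_dist x w'
      have hP : (r.concat ha).IsPath := by
        apply SimpleGraph.Walk.isPath_of_length_eq_dist
        rw [SimpleGraph.Walk.length_concat]; omega
      have := (hG.existsUnique_path x w).unique hP hq
      rw [← this, SimpleGraph.Walk.penultimate_concat]
    refine ⟨q.penultimate, fun _ => ⟨hadj, ?_, huniq⟩⟩
    rcases hG.dist_eq_dist_add_one_of_adj x hadj with h | h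
    · exfalso
      have h1 := SimpleGraph.dist_le q.dropLast
      have h2 : q.dropLast.length = q.length - 1 := by simp
      omega
    · exact h
  choose p hp using this
  exact ⟨p, hp⟩

theorem t6iso_dist {V : Type*} (G : SimpleGraph V) (hG : G.Connected) (σ : G ≃g G) (u v : V) :
    G.dist (σ u) (σ v) = G.dist u v := by
  have h : ∀ (τ : G ≃g G) u v, G.dist (τ u) (τ v) ≤ G.dist u v := by
    intro τ u v
    obtain ⟨q, hq⟩ := hG.exists_walk_length_eq_dist u v
    rw [← hq, ← SimpleGraph.Walk.length_map τ.toHom q]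
    exact SimpleGraph.dist_le _
  apply le_antisymm (h σ u v)
  simpa using h σ.symm (σ u) (σ v)

theorem stmt6 {V : Type*} [Fintype V] (G : SimpleGraph V) (hG : G.IsTree)
    (x : V) (k : ℕ) (L : V → Finset ℕ) (hL : ∀ v, (L v).card = k) :
    DCount G x k ≤ DCountL G x L := by
  classical
  obtain ⟨p, hpp⟩ := t6parent G hG x
  set d : V → ℕ := fun w => G.dist x w with hd
  have d0 : d x = 0 := by simp [hd]
  have hp : ∀ w, w ≠ x → d w = d (p w) + 1 := fun w hw => (hpp w hw).2.1
  obtain ⟨N, hN⟩ : ∃ N, ∀ w, d w < N :=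
    ⟨Finset.univ.sup d + 1, fun w => Nat.lt_succ_of_le (Finset.le_sup (Finset.mem_univ w))⟩
  have hAdj : ∀ a b, G.Adj a b ↔ (b ≠ x ∧ p b = a) ∨ (a ≠ x ∧ p a = b) := by
    intro a b
    have hne : ∀ a b, d b = d a + 1 → b ≠ x := by
      rintro a b h rfl; omega
    constructor
    · intro h
      rcases hG.dist_eq_dist_add_one_of_adj x h with h' | h'
      · exact Or.inr ⟨hne b a h', ((hpp a (hne b a h')).2.2 b h.symm h').symm⟩
      · exact Or.inl ⟨hne a b h', ((hpp b (hne a b h')).2.2 a h h').symm⟩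
    · rintro (⟨h, rfl⟩ | ⟨h, rfl⟩)
      · exact (hpp b h).1
      · exact (hpp a h).1.symm
  have hσp : ∀ σ : G ≃g G, σ x = x →
      (∀ w, d (σ w) = d w) ∧ ∀ w, w ≠ x → p (σ w) = σ (p w) := by
    intro σ hx
    have h1 : ∀ w, d (σ w) = d w := by
      intro w
      have := t6iso_dist G hG.connected σ x w
      rwa [hx] at this
    refine ⟨h1, fun w hw => ?_⟩
    have hσw : σ w ≠ x := fun h => hw (σ.injective (h.trans hx.symm))
    refine ((hpp (σ w) hσw).2.2 (σ (p w)) (σ.map_adj_iff.2 (hpp w hw).1) ?_).symm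
    have e1 := h1 w
    have e2 := h1 (p w)
    have e3 := hp w hw
    show d (σ w) = d (σ (p w)) + 1
    omega
  have hinv : ∀ φ ψ : V → ℕ, (∃ σ : G ≃g G, σ x = x ∧ ∀ w, φ w = ψ (σ w)) →
      t6c x p d N φ x = t6c x p d N ψ x := by
    rintro φ ψ ⟨σ, hx, h⟩
    have := t6code_inv σ.toEquiv hx (hσp σ hx).2 φ ψ h (N - d x) x
    unfold t6c
    rw [this]
    congr 1
  set C := t6C x p with hC
  calc DCount G x k ≤ Nat.card (t6AA C k N (t6sh C N x)) := ?_
    _ = (t6AA C k N (t6sh C N x)).card := by simp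
    _ ≤ (t6SS C L N x).card := t6count C k L hL N x
    _ = Nat.card (t6SS C L N x) := by simp
    _ ≤ DCountL G x L := ?_
  · unfold DCount
    have hDN : ∀ f : V → Fin k, Distinguishes G x f → Distinguishes G x (fun v => (f v : ℕ)) := by
      intro f hf σ hx h
      exact hf σ hx (fun w => Fin.ext (h w))
    refine Nat.card_le_card_of_injective (Quot.lift (fun f => ⟨t6c x p d N (fun v => (f.1 v : ℕ)) x, ?_⟩) ?_) ?_
    · rw [t6mem_AA]
      refine ⟨x, rfl, ?_⟩
      exact t6code_mem hp hN (fun _ => Finset.range k) _ (fun v => Finset.mem_range.2 (f.1 v).2)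
        (t6good G d0 hp hN hAdj _ (hDN f.1 f.2)) N x (by rw [d0]; rfl)
    · rintro f g ⟨σ, hx, h⟩
      apply Subtype.ext
      exact hinv _ _ ⟨σ, hx, fun w => by rw [h w]⟩
    · intro F F'
      induction F using Quot.ind with | _ f
      induction F' using Quot.ind with | _ g
      intro h
      have h' := congrArg Subtype.val h
      simp only at h'
      obtain ⟨β, hβ⟩ := t6valid_exists hp hN (fun v => (f.1 v : ℕ)) (fun v => (g.1 v : ℕ))
      obtain ⟨σ, s0, s1, _⟩ := t6iso G d0 hp hN hAdj _ _ h' β hβ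
      exact Quot.sound ⟨σ, s0, fun w => Fin.ext (s1 w)⟩
  · unfold DCountL
    have hfin : Finite {f : V → ℕ // (∀ v, f v ∈ L v) ∧ Distinguishes G x f} := by
      have : Finite {f : V → ℕ // f ∈ Fintype.piFinset L} := inferInstance
      refine Finite.of_injective
        (fun f => (⟨f.1, Fintype.mem_piFinset.2 f.2.1⟩ : {f : V → ℕ // f ∈ Fintype.piFinset L})) ?_
      intro f g h
      have h' : f.1 = g.1 := congrArg (fun z : {f : V → ℕ // f ∈ Fintype.piFinset L} => z.1) h
      exact Subtype.ext h'
    have hr := fun s : t6SS C L N x => t6realize d0 hp hN L s.1 s.2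
    choose φ h1 h2 h3 using hr
    refine Nat.card_le_card_of_injective
      (fun s => Quot.mk _ ⟨φ s, h1 s, t6dist G hp hσp _ (h3 s)⟩) ?_
    intro s t h
    have := congrArg (Quot.lift (fun f => t6c x p d N f.1 x)
      (fun f g h => hinv f.1 g.1 h)) h
    simp only [h2] at this
    exact Subtype.ext this
end
end

section
/- For every rooted tree T, the list distinguishing number equals the distinguishing number: D_ℓ(T) = D(T). -/
open SimpleGraph

noncomputable section

section Aux
open scoped Classical

lemma mset_equiv {ι κ : Type*} [Fintype ι] [Fintype κ] {β : Type*} (s : ι → β) (t : κ → β)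
    (h : (Finset.univ : Finset ι).val.map s = (Finset.univ : Finset κ).val.map t) :
    ∃ e : ι ≃ κ, ∀ i, s i = t (e i) := by
  have hc : ∀ c, Fintype.card {i // s i = c} = Fintype.card {j // t j = c} := by
    intro c
    have := congrArg (Multiset.count c) h
    rw [Multiset.count_map, Multiset.count_map] at this
    rw [Fintype.card_subtype, Fintype.card_subtype, Finset.card_def, Finset.card_def,
      Finset.filter_val, Finset.filter_val]
    simpa [eq_comm] using this
  let E : ∀ c, {i // s i = c} ≃ {j // t j = c} := fun c => Fintype.equivOfCardEq (hc c)
  refine ⟨(Equiv.sigmaFiberEquiv s).symm.trans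
    ((Equiv.sigmaCongrRight E).trans (Equiv.sigmaFiberEquiv t)), ?_⟩
  intro i
  simp only [Equiv.trans_apply]
  exact ((E (s i)) ⟨i, rfl⟩).2.symm

lemma mset_of_equiv {ι κ : Type*} [Fintype ι] [Fintype κ] {β : Type*} (s : ι → β) (t : κ → β)
    (e : ι ≃ κ) (h : ∀ i, s i = t (e i)) :
    (Finset.univ : Finset ι).val.map s = (Finset.univ : Finset κ).val.map t := by
  rw [← Multiset.map_univ_val_equiv e, Multiset.map_map]
  exact Multiset.map_congr rfl (fun i _ => h i)

def JJ {ι : Type*} [Fintype ι] (A : ι → Finset ℕ) : Finset (ι → ℕ) :=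
  (Fintype.piFinset A).filter Function.Injective

lemma mem_JJ {ι : Type*} [Fintype ι] (A : ι → Finset ℕ) (f : ι → ℕ) :
    f ∈ JJ A ↔ (∀ i, f i ∈ A i) ∧ Function.Injective f := by
  simp [JJ]

lemma JJ_option {α : Type*} [Fintype α] (A : Option α → Finset ℕ) :
    (JJ A).card = ∑ f ∈ JJ (fun a => A (some a)), (A none \ Finset.univ.image f).card := by
  rw [← Finset.card_sigma]
  refine Finset.card_bij' (fun g _ => ⟨fun a => g (some a), g none⟩)
    (fun p _ => fun o => o.elim p.2 p.1) ?_ ?_ ?_ ?_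
  · intro g hg
    rw [mem_JJ] at hg
    simp only [Finset.mem_sigma, mem_JJ, Finset.mem_sdiff, Finset.mem_image, Finset.mem_univ,
      true_and, not_exists]
    refine ⟨⟨fun i => hg.1 _, fun a b hab => ?_⟩, hg.1 _, fun x hx => ?_⟩
    · simpa using hg.2 hab
    · simpa using hg.2 hx
  · rintro ⟨f, x⟩ hp
    simp only [Finset.mem_sigma, mem_JJ, Finset.mem_sdiff, Finset.mem_image, Finset.mem_univ,
      true_and, not_exists] at hp
    rw [mem_JJ]
    obtain ⟨⟨h1, h2⟩, h3, h4⟩ := hp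
    constructor
    · rintro (_ | i)
      · exact h3
      · exact h1 i
    · rintro (_ | i) (_ | j) hij
      · rfl
      · exact absurd hij.symm (h4 j)
      · exact absurd hij (h4 i)
      · exact congrArg some (h2 hij)
  · intro g hg
    funext o
    cases o <;> rfl
  · rintro ⟨f, x⟩ hp
    rfl

lemma JJ_equiv {α β : Type*} [Fintype α] [Fintype β] (e : α ≃ β) (A : β → Finset ℕ) :
    (JJ A).card = (JJ (fun a => A (e a))).card := by
  refine Finset.card_bij' (fun g _ => g ∘ e) (fun g _ => g ∘ e.symm) ?_ ?_ ?_ ?_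
  · intro g hg
    rw [mem_JJ] at hg ⊢
    exact ⟨fun i => hg.1 _, hg.2.comp e.injective⟩
  · intro g hg
    rw [mem_JJ] at hg ⊢
    exact ⟨fun i => by simpa using hg.1 (e.symm i), hg.2.comp e.symm.injective⟩
  · intro g _
    funext o
    simp
  · intro g _
    funext o
    simp

lemma JJ_le (ι : Type*) [Fintype ι] : ∀ (sh : ι → ℕ) (A B : ι → Finset ℕ),
    (∀ i, (B i).card ≤ (A i).card) → (∀ i j, sh i = sh j → B i = B j) →
    (∀ i j c, c ∈ A i → c ∈ A j → sh i = sh j) → (JJ B).card ≤ (JJ A).card := by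
  refine Fintype.induction_empty_option
    (P := fun (ι : Type _) [Fintype ι] => ∀ (sh : ι → ℕ) (A B : ι → Finset ℕ),
    (∀ i, (B i).card ≤ (A i).card) → (∀ i j, sh i = sh j → B i = B j) →
    (∀ i j c, c ∈ A i → c ∈ A j → sh i = sh j) → (JJ B).card ≤ (JJ A).card) ?_ ?_ ?_ ι
  · intro α β _ e ih sh A B h1 h2 h3
    let _ := Fintype.ofEquiv β e.symm
    rw [JJ_equiv e A, JJ_equiv e B]
    convert ih (fun a => sh (e a)) (fun a => A (e a)) (fun a => B (e a)) (fun i => h1 _)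
      (fun i j => h2 _ _) (fun i j => h3 _ _)
  · intro sh A B _ _ _
    have : ∀ A : PEmpty → Finset ℕ, JJ A = {fun x => x.elim} := by
      intro A
      ext f
      rw [mem_JJ, Finset.mem_singleton]
      refine ⟨fun _ => funext fun x => x.elim, fun _ => ⟨fun x => x.elim, fun x => x.elim⟩⟩
    rw [this A, this B]
  · intro α _ ih sh A B h1 h2 h3
    have := ih (fun a => sh (some a)) (fun a => A (some a)) (fun a => B (some a)) (fun i => h1 _)
      (fun i j => h2 _ _) (fun i j => h3 _ _)
    rw [JJ_option, JJ_option]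
    set m := (Finset.univ.filter (fun a : α => sh (some a) = sh none)).card with hm
    calc _ ≤ ∑ f ∈ JJ (fun a => B (some a)), ((B none).card - m) := by
            refine Finset.sum_le_sum fun f hf => ?_
            rw [mem_JJ] at hf
            have hsub : (Finset.univ.filter (fun a : α => sh (some a) = sh none)).image f ⊆ B none := by
              intro x hx
              simp only [Finset.mem_image, Finset.mem_filter, Finset.mem_univ, true_and] at hx
              obtain ⟨a, ha, rfl⟩ := hx
              rw [← h2 _ _ ha]
              exact hf.1 a
            have : m = ((Finset.univ.filter (fun a : α => sh (some a) = sh none)).image f).card := by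
              rw [Finset.card_image_of_injective _ hf.2]
            rw [this, ← Finset.card_sdiff_of_subset hsub]
            apply Finset.card_le_card
            apply Finset.sdiff_subset_sdiff le_rfl
            exact Finset.image_subset_image (Finset.subset_univ _)
      _ = (JJ (fun a => B (some a))).card * ((B none).card - m) := by simp
      _ ≤ (JJ (fun a => A (some a))).card * ((A none).card - m) := by
            refine Nat.mul_le_mul this ?_
            have := h1 none
            omega
      _ = ∑ f ∈ JJ (fun a => A (some a)), ((A none).card - m) := by simp
      _ ≤ _ := by
            refine Finset.sum_le_sum fun f hf => ?_
            rw [mem_JJ] at hf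
            have : A none \ ((Finset.univ.filter (fun a : α => sh (some a) = sh none)).image f) ⊆
               A none \ Finset.univ.image f := by
              intro x hx
              simp only [Finset.mem_sdiff, Finset.mem_image, Finset.mem_filter, Finset.mem_univ,
                true_and, not_exists, not_and] at hx ⊢
              refine ⟨hx.1, fun a ha => hx.2 a ?_ ha⟩
              subst ha
              exact h3 _ _ _ (hf.1 a) hx.1
            refine le_trans ?_ (Finset.card_le_card this)
            refine le_trans ?_ (Finset.le_card_sdiff _ _)
            rw [Finset.card_image_of_injective _ hf.2]

def mimg {ι : Type*} [Fintype ι] (s : ι → ℕ) : Multiset ℕ := (Finset.univ : Finset ι).val.map s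

lemma JJ_img_le {ι : Type*} [Fintype ι] (sh : ι → ℕ) (A B : ι → Finset ℕ)
    (h1 : ∀ i, (B i).card ≤ (A i).card) (h2 : ∀ i j, sh i = sh j → B i = B j)
    (h3 : ∀ i j c, c ∈ A i → c ∈ A j → sh i = sh j) :
    ((JJ B).image mimg).card ≤ ((JJ A).image mimg).card := by
  set Γ : Finset (Equiv.Perm ι) := Finset.univ.filter (fun p => ∀ i, sh (p i) = sh i) with hΓ
  have hpos : 0 < Γ.card := Finset.card_pos.2 ⟨1, by simp [hΓ]⟩
  have a1 : (JJ A).card ≤ Γ.card * ((JJ A).image mimg).card := by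
    refine Finset.card_le_mul_card_image _ _ ?_
    intro M hM
    obtain ⟨s0, hs0, rfl⟩ := Finset.mem_image.1 hM
    rw [mem_JJ] at hs0
    refine le_trans (Finset.card_le_card (t := Γ.image (fun p : Equiv.Perm ι => s0 ∘ p)) ?_)
      Finset.card_image_le
    intro s hs
    rw [Finset.mem_filter, mem_JJ] at hs
    obtain ⟨e, he⟩ := mset_equiv _ _ hs.2
    refine Finset.mem_image.2 ⟨e, ?_, (funext he).symm⟩
    simp only [hΓ, Finset.mem_filter, Finset.mem_univ, true_and]
    intro i
    refine h3 _ _ (s i) ?_ (hs.1.1 i)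
    rw [he]
    exact hs0.1 _
  have a2 : Γ.card * ((JJ B).image mimg).card ≤ (JJ B).card := by
    refine Finset.mul_card_image_le_card _ _ ?_
    intro M hM
    obtain ⟨s0, hs0, rfl⟩ := Finset.mem_image.1 hM
    rw [mem_JJ] at hs0
    rw [← Finset.card_image_of_injective (f := (fun p : Equiv.Perm ι => s0 ∘ p)) Γ]
    · apply Finset.card_le_card
      intro s hs
      obtain ⟨p, hp, rfl⟩ := Finset.mem_image.1 hs
      simp only [hΓ, Finset.mem_filter, Finset.mem_univ, true_and] at hp
      rw [Finset.mem_filter, mem_JJ]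
      refine ⟨⟨fun i => ?_, hs0.2.comp p.injective⟩, mset_of_equiv _ _ p (fun i => rfl)⟩
      rw [← h2 _ _ (hp i)]
      exact hs0.1 _
    · intro p q hpq
      ext i
      exact hs0.2 (congrFun hpq i)
  have a3 := JJ_le ι sh A B h1 h2 h3
  exact Nat.le_of_mul_le_mul_left (a2.trans (a3.trans a1)) hpos

structure PT {V : Type*} (r : V) where
  par : V → V
  d : V → ℕ
  par_r : par r = r
  hd : ∀ x, x ≠ r → d x = d (par x) + 1

abbrev PT.Ch {V : Type*} {r : V} (P : PT r) (v : V) : Type _ := {x : V // x ≠ r ∧ P.par x = v}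

section PTsec
variable {V : Type*} [Fintype V] {r : V} (P : PT r)

lemma PT.exN : ∃ N, ∀ v, P.d v < N :=
  ⟨Finset.univ.sup P.d + 1, fun v => Nat.lt_succ_of_le (Finset.le_sup (Finset.mem_univ v))⟩

lemma PT.d_ch (v : V) (u : P.Ch v) : P.d u.1 = P.d v + 1 := by
  rw [P.hd _ u.2.1, u.2.2]

lemma PT.botInd (Q : V → Prop) (h : ∀ v, (∀ u : P.Ch v, Q u.1) → Q v) (v : V) : Q v := by
  obtain ⟨N, hN⟩ := P.exN
  have : ∀ n v, N - P.d v ≤ n → Q v := by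
    intro n
    induction n with
    | zero => intro v hv; have := hN v; omega
    | succ n ih =>
      intro v hv
      refine h v fun u => ih _ ?_
      have := P.d_ch v u
      have := hN u.1
      omega
  exact this _ v le_rfl

lemma PT.botRec {β : Type*} [Inhabited β] (F : ∀ v, (P.Ch v → β) → β) :
    ∃ f : V → β, ∀ v, f v = F v (fun u => f u.1) := by
  obtain ⟨N, hN⟩ := P.exN
  let g : ℕ → V → β := fun n => Nat.rec (fun _ => default) (fun _ g v => F v (fun u => g u.1)) n
  refine ⟨fun v => g (N - P.d v) v, fun v => ?_⟩
  have e : N - P.d v = (N - P.d v - 1) + 1 := by have := hN v; omega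
  show g (N - P.d v) v = _
  rw [e]
  show F v (fun u => g (N - P.d v - 1) u.1) = _
  congr 1
  funext u
  show _ = g (N - P.d u.1) u.1
  rw [P.d_ch v u, Nat.sub_sub]

lemma PT.topInd (Q : V → Prop) (h0 : Q r) (h : ∀ x, x ≠ r → Q (P.par x) → Q x) (v : V) : Q v := by
  have : ∀ n v, P.d v ≤ n → Q v := by
    intro n
    induction n with
    | zero =>
      intro v hv
      by_cases hr : v = r
      · exact hr ▸ h0
      · have := P.hd v hr; omega
    | succ n ih =>
      intro v hv
      by_cases hr : v = r
      · exact hr ▸ h0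
      · have := P.hd v hr
        exact h v hr (ih _ (by omega))
  exact this _ v le_rfl

lemma PT.topRec {β : Type*} (b : β) (F : V → β → β) :
    ∃ f : V → β, f r = b ∧ ∀ x, x ≠ r → f x = F x (f (P.par x)) := by
  obtain ⟨N, hN⟩ := P.exN
  let g : ℕ → V → β := fun n => Nat.rec (fun _ => b)
    (fun _ g v => if v = r then b else F v (g (P.par v))) n
  have hg : ∀ n v, P.d v < n → ∀ m, P.d v < m → g n v = g m v := by
    intro n
    induction n with
    | zero => intro v hv; omega
    | succ n ih =>
      intro v hv m hm
      obtain ⟨m, rfl⟩ : ∃ m', m = m' + 1 := ⟨m - 1, by omega⟩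
      show (if v = r then b else F v (g n (P.par v))) = (if v = r then b else F v (g m (P.par v)))
      split_ifs with hr
      · rfl
      · have := P.hd v hr
        rw [ih (P.par v) (by omega) m (by omega)]
  refine ⟨g (N + 1), if_pos rfl, fun x hx => ?_⟩
  show (if x = r then b else F x (g N (P.par x))) = _
  rw [if_neg hx, hg N _ (hN _) (N + 1) (by have := hN (P.par x); omega)]

def enc (c : ℕ) (M : Multiset ℕ) : ℕ := Encodable.encode (c, M)

lemma enc_inj {c c' : ℕ} {M M' : Multiset ℕ} (h : enc c M = enc c' M') : c = c' ∧ M = M' := by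
  have := Encodable.encode_injective h
  simpa using this

def PT.code (φ : V → ℕ) : V → ℕ := (P.botRec (fun v f => enc (φ v) (mimg f))).choose

lemma PT.code_eq (φ : V → ℕ) (v : V) :
    P.code φ v = enc (φ v) (mimg (fun u : P.Ch v => P.code φ u.1)) :=
  (P.botRec (fun v f => enc (φ v) (mimg f))).choose_spec v

def PT.Cstep (L : V → Finset ℕ) (v : V) (A : P.Ch v → Finset ℕ) : Finset ℕ :=
  (L v ×ˢ (JJ A).image mimg).image (fun p => enc p.1 p.2)

def PT.C (L : V → Finset ℕ) : V → Finset ℕ := (P.botRec (P.Cstep L)).choose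

lemma PT.C_eq (L : V → Finset ℕ) (v : V) :
    P.C L v = (L v ×ˢ (JJ (fun u : P.Ch v => P.C L u.1)).image mimg).image
      (fun p => enc p.1 p.2) :=
  (P.botRec (P.Cstep L)).choose_spec v

lemma PT.mem_C (L : V → Finset ℕ) (v : V) (c : ℕ) : c ∈ P.C L v ↔
    ∃ a ∈ L v, ∃ s : P.Ch v → ℕ, (∀ u, s u ∈ P.C L u.1) ∧ Function.Injective s ∧
      c = enc a (mimg s) := by
  rw [P.C_eq]
  simp only [Finset.mem_image, Finset.mem_product, mem_JJ, Prod.exists]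
  constructor
  · rintro ⟨a, M, ⟨ha, s, hs, rfl⟩, rfl⟩
    exact ⟨a, ha, s, hs.1, hs.2, rfl⟩
  · rintro ⟨a, ha, s, h1, h2, rfl⟩
    exact ⟨a, _, ⟨ha, s, ⟨h1, h2⟩, rfl⟩, rfl⟩

lemma PT.C_card (L : V → Finset ℕ) (v : V) : (P.C L v).card =
    (L v).card * ((JJ (fun u : P.Ch v => P.C L u.1)).image mimg).card := by
  rw [P.C_eq, Finset.card_image_of_injective, Finset.card_product]
  rintro ⟨a, b⟩ ⟨c, e⟩ h
  obtain ⟨h1, h2⟩ := enc_inj h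
  exact Prod.ext h1 h2

def PT.sh : V → ℕ := P.code (fun _ => 0)

lemma PT.sh_iff (u v : V) : P.sh u = P.sh v ↔
    ∃ e : P.Ch u ≃ P.Ch v, ∀ i, P.sh i.1 = P.sh (e i).1 := by
  unfold PT.sh
  rw [P.code_eq _ u, P.code_eq _ v]
  constructor
  · intro h
    exact mset_equiv _ _ (enc_inj h).2
  · rintro ⟨e, he⟩
    exact congrArg (enc 0) (mset_of_equiv _ _ e he)

lemma PT.C_sh (L L' : V → Finset ℕ) (u : V) : ∀ v c, c ∈ P.C L u → c ∈ P.C L' v →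
    P.sh u = P.sh v := by
  refine P.botInd (fun u => ∀ v c, c ∈ P.C L u → c ∈ P.C L' v → P.sh u = P.sh v) ?_ u
  intro u ih v c hu hv
  obtain ⟨a, ha, s, hs, hi, rfl⟩ := (P.mem_C _ _ _).1 hu
  obtain ⟨b, hb, t, ht, hj, h⟩ := (P.mem_C _ _ _).1 hv
  obtain ⟨e, he⟩ := mset_equiv _ _ (enc_inj h).2
  refine (P.sh_iff u v).2 ⟨e, fun i => ih i _ _ (hs i) ?_⟩
  rw [he]
  exact ht _

lemma PT.C_const (K : Finset ℕ) (u : V) : ∀ v, P.sh u = P.sh v →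
    P.C (fun _ => K) u = P.C (fun _ => K) v := by
  refine P.botInd (fun u => ∀ v, P.sh u = P.sh v →
    P.C (fun _ => K) u = P.C (fun _ => K) v) ?_ u
  intro u ih v h
  obtain ⟨e, he⟩ := (P.sh_iff u v).1 h
  ext c
  rw [P.mem_C, P.mem_C]
  constructor
  · rintro ⟨a, ha, s, hs, hi, rfl⟩
    refine ⟨a, ha, s ∘ e.symm, fun w => ?_, hi.comp e.symm.injective, ?_⟩
    · have := ih (e.symm w) _ (he _)
      rw [e.apply_symm_apply] at this
      rw [← this]
      exact hs _
    · exact congrArg (enc a) (mset_of_equiv _ _ e (by simp))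
  · rintro ⟨a, ha, s, hs, hi, rfl⟩
    refine ⟨a, ha, s ∘ e, fun w => ?_, hi.comp e.injective, ?_⟩
    · rw [ih w _ (he _)]
      exact hs _
    · exact congrArg (enc a) (mset_of_equiv _ _ e.symm (by simp))

lemma PT.C_le (K : Finset ℕ) (L : V → Finset ℕ) (h : ∀ v, (L v).card = K.card) (v : V) :
    (P.C (fun _ => K) v).card ≤ (P.C L v).card := by
  refine P.botInd (fun v => (P.C (fun _ => K) v).card ≤ (P.C L v).card) ?_ v
  intro v ih
  rw [P.C_card, P.C_card, h]
  refine Nat.mul_le_mul_left _ (JJ_img_le (fun u => P.sh u.1) _ _ ih ?_ ?_)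
  · intro i j hij
    exact P.C_const K _ _ hij
  · intro i j c hi hj
    exact P.C_sh L L _ _ c hi hj

/-- Good colorings. -/
def PT.Good (φ : V → ℕ) : Prop :=
  ∀ v, Function.Injective (fun u : P.Ch v => P.code φ u.1)

lemma PT.code_mem (L : V → Finset ℕ) (φ : V → ℕ) (hL : ∀ v, φ v ∈ L v) (hg : P.Good φ) (v : V) :
    P.code φ v ∈ P.C L v := by
  refine P.botInd (fun v => P.code φ v ∈ P.C L v) ?_ v
  intro v ih
  exact (P.mem_C _ _ _).2 ⟨φ v, hL v, _, ih, hg v, P.code_eq φ v⟩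

lemma PT.exists_good (L : V → Finset ℕ) (c : ℕ) (hc : c ∈ P.C L r) :
    ∃ φ : V → ℕ, (∀ v, φ v ∈ L v) ∧ P.Good φ := by
  have key : ∀ v c, ∃ a, ∃ s : P.Ch v → ℕ, c ∈ P.C L v →
      (a ∈ L v ∧ (∀ u, s u ∈ P.C L u.1) ∧ Function.Injective s ∧ c = enc a (mimg s)) := by
    intro v c
    by_cases h : c ∈ P.C L v
    · obtain ⟨a, ha, s, h⟩ := (P.mem_C _ _ _).1 h
      exact ⟨a, s, fun _ => ⟨ha, h⟩⟩
    · exact ⟨0, fun _ => 0, fun h' => absurd h' h⟩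
  choose a s H using key
  obtain ⟨t, t0, ht⟩ := P.topRec c
    (fun x b => if hx : x ≠ r then s (P.par x) b ⟨x, hx, rfl⟩ else 0)
  have ht' : ∀ v (u : P.Ch v), t u.1 = s v (t v) u := by
    rintro v ⟨u, hu, rfl⟩
    rw [ht u hu, dif_pos hu]
  have hm : ∀ v, t v ∈ P.C L v := by
    intro v
    refine P.topInd (fun v => t v ∈ P.C L v) (t0 ▸ hc) ?_ v
    intro x hx ih
    have := ht' _ (⟨x, hx, rfl⟩ : P.Ch (P.par x))
    rw [this]
    exact (H _ _ ih).2.1 _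
  have hcode : ∀ v, P.code (fun v => a v (t v)) v = t v := by
    intro v
    refine P.botInd (fun v => P.code (fun v => a v (t v)) v = t v) ?_ v
    intro v ih
    have e : (fun u : P.Ch v => P.code (fun v => a v (t v)) u.1) = s v (t v) := by
      funext u
      rw [ih, ht']
    rw [P.code_eq, e]
    exact (H _ _ (hm v)).2.2.2.symm
  refine ⟨fun v => a v (t v), fun v => (H _ _ (hm v)).1, fun v x y hxy => ?_⟩
  simp only [hcode, ht'] at hxy
  exact (H _ _ (hm v)).2.2.1 hxy

lemma PT.good_dist (G : SimpleGraph V)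
    (hadj : ∀ x y, G.Adj x y ↔ x ≠ y ∧ (P.par x = y ∨ P.par y = x))
    (hconn : G.Connected) (hdist : ∀ x, P.d x = G.dist x r)
    (φ : V → ℕ) (hg : P.Good φ) : Distinguishes G r φ := by
  intro σ hσ hφ
  have hle : ∀ (τ : G ≃g G), τ r = r → ∀ x, P.d (τ x) ≤ P.d x := by
    intro τ hτ x
    obtain ⟨p, hp⟩ := hconn.exists_walk_length_eq_dist x r
    rw [hdist, hdist, ← hp]
    have := SimpleGraph.dist_le (p.map τ.toHom)
    rw [SimpleGraph.Walk.length_map] at this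
    have e : τ.toHom r = r := hτ
    rw [e] at this
    exact this
  have hs : σ.symm r = r := by
    rw [RelIso.symm_apply_eq]
    exact hσ.symm
  have hdσ : ∀ x, P.d (σ x) = P.d x := by
    intro x
    refine le_antisymm (hle σ hσ x) ?_
    have := hle σ.symm hs (σ x)
    simpa using this
  have hne : ∀ x, x ≠ r → σ x ≠ r := by
    intro x hx h
    exact hx (σ.injective (h.trans hσ.symm))
  have hpar : ∀ x, P.par (σ x) = σ (P.par x) := by
    intro x
    by_cases hx : x = r
    · rw [hx, P.par_r, hσ, P.par_r]
    · have h1 : G.Adj x (P.par x) := by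
        rw [hadj]
        refine ⟨fun h => ?_, Or.inl rfl⟩
        have := P.hd x hx
        rw [← h] at this
        omega
      have h2 : G.Adj (σ x) (σ (P.par x)) := σ.map_rel_iff.2 h1
      rw [hadj] at h2
      rcases h2.2 with h | h
      · exact h
      · exfalso
        have a1 := hdσ x
        have a2 := hdσ (P.par x)
        have a3 := P.hd x hx
        by_cases hr : P.par x = r
        · rw [hr, hσ, P.par_r] at h
          exact hne x hx h.symm
        · have a4 := P.hd _ (hne _ hr)
          rw [h] at a4
          omega
  have hcode : ∀ v, P.code φ (σ v) = P.code φ v := by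
    intro v
    refine P.botInd (fun v => P.code φ (σ v) = P.code φ v) ?_ v
    intro v ih
    rw [P.code_eq _ v, P.code_eq _ (σ v), hφ]
    congr 1
    symm
    have hch : ∀ x, (x ≠ r ∧ P.par x = v) ↔ (σ x ≠ r ∧ P.par (σ x) = σ v) := by
      intro x
      rw [hpar, σ.injective.eq_iff]
      refine and_congr_left fun _ => ⟨hne x, fun h hx => h (by rw [hx, hσ])⟩
    exact mset_of_equiv _ _ (σ.toEquiv.subtypeEquiv hch) (fun i => (ih i).symm)
  intro w
  refine P.topInd (fun w => σ w = w) hσ ?_ w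
  intro x hx ih
  have := @hg (P.par x) ⟨σ x, hne x hx, by rw [hpar, ih]⟩ ⟨x, hx, rfl⟩ (hcode x)
  exact congrArg Subtype.val this

lemma PT.dist_good (G : SimpleGraph V)
    (hadj : ∀ x y, G.Adj x y ↔ x ≠ y ∧ (P.par x = y ∨ P.par y = x))
    (φ : V → ℕ) (hD : Distinguishes G r φ) : P.Good φ := by
  intro p a b hab
  by_contra hne
  have hab' : P.code φ a.1 = P.code φ b.1 := hab
  have key : ∀ u v, ∃ e : P.Ch u → V, P.code φ u = P.code φ v →
      ((∀ i, e i ≠ r ∧ P.par (e i) = v ∧ P.code φ (e i) = P.code φ i.1) ∧ Function.Injective e ∧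
        (∀ h : u = p, v = p → e (h ▸ a) = b.1)) := by
    intro u v
    by_cases h : P.code φ u = P.code φ v
    · by_cases hp : u = p ∧ v = p
      · obtain ⟨rfl, rfl⟩ := hp
        refine ⟨fun i => (Equiv.swap a b i).1, fun _ => ⟨fun i => ?_, ?_, ?_⟩⟩
        · refine ⟨(Equiv.swap a b i).2.1, (Equiv.swap a b i).2.2, ?_⟩
          show P.code φ (Equiv.swap a b i).1 = P.code φ i.1
          rw [Equiv.swap_apply_def]
          split_ifs with h1 h2
          · rw [h1, hab']
          · rw [h2, hab']
          · rfl
        · exact Subtype.val_injective.comp (Equiv.injective _)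
        · intro _ _
          simp
      · have h' := h
        rw [P.code_eq _ u, P.code_eq _ v] at h'
        obtain ⟨e, he⟩ := mset_equiv _ _ (enc_inj h').2
        refine ⟨fun i => (e i).1, fun _ => ⟨fun i => ⟨(e i).2.1, (e i).2.2, (he i).symm⟩,
          Subtype.val_injective.comp e.injective, fun h1 h2 => absurd ⟨h1, h2⟩ hp⟩⟩
    · exact ⟨fun i => i.1, fun h' => absurd h' h⟩
  choose e he using key
  obtain ⟨t, t0, ht⟩ := P.topRec r
    (fun x b => if hx : x ≠ r then e (P.par x) b ⟨x, hx, rfl⟩ else r)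
  have ht' : ∀ v (u : P.Ch v), t u.1 = e v (t v) u := by
    rintro v ⟨u, hu, rfl⟩
    rw [ht u hu, dif_pos hu]
  have hcode : ∀ v, P.code φ v = P.code φ (t v) := by
    intro v
    refine P.topInd (fun v => P.code φ v = P.code φ (t v)) (by rw [t0]) ?_ v
    intro x hx ih
    have h1 := ht' _ (⟨x, hx, rfl⟩ : P.Ch (P.par x))
    have h2 := ((he _ _ ih).1 ⟨x, hx, rfl⟩).2.2
    rw [← h1] at h2
    exact h2.symm
  have hch : ∀ x, x ≠ r → t x ≠ r ∧ P.par (t x) = t (P.par x) := by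
    intro x hx
    have h1 := ht' _ (⟨x, hx, rfl⟩ : P.Ch (P.par x))
    have h2 := ((he _ _ (hcode (P.par x))).1 ⟨x, hx, rfl⟩)
    rw [← h1] at h2
    exact ⟨h2.1, h2.2.1⟩
  have hpar : ∀ x, P.par (t x) = t (P.par x) := by
    intro x
    by_cases hx : x = r
    · rw [hx, P.par_r, t0, P.par_r]
    · exact (hch x hx).2
  have hinj : ∀ x y, t x = t y → x = y := by
    intro x
    refine P.topInd (fun x => ∀ y, t x = t y → x = y) ?_ ?_ x
    · intro y hy
      by_contra h
      exact (hch y (Ne.symm h)).1 (hy ▸ t0)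
    · intro x hx ih y hxy
      have hy : y ≠ r := by
        rintro rfl
        exact (hch x hx).1 (hxy.trans t0)
      have hp : P.par x = P.par y := ih _ (by rw [← hpar, ← hpar, hxy])
      have h1 := ht' _ (⟨x, hx, rfl⟩ : P.Ch (P.par x))
      have h2 := ht' _ (⟨y, hy, hp.symm⟩ : P.Ch (P.par x))
      have := (he _ _ (hcode (P.par x))).2.1 (h1.symm.trans (hxy.trans h2))
      exact congrArg Subtype.val this
  have hbij : Function.Bijective t := Finite.injective_iff_bijective.1 (fun x y => hinj x y)
  let σ : G ≃g G :=
    { toEquiv := Equiv.ofBijective t hbij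
      map_rel_iff' := by
        intro x y
        show G.Adj (t x) (t y) ↔ G.Adj x y
        rw [hadj, hadj, hpar, hpar, hbij.1.eq_iff, hbij.1.eq_iff, hbij.1.ne_iff] }
  have hσ : ∀ x, σ x = t x := fun _ => rfl
  have hφ : ∀ w, φ (σ w) = φ w := by
    intro w
    rw [hσ]
    have := hcode w
    rw [P.code_eq, P.code_eq _ (t w)] at this
    exact (enc_inj this).1.symm
  have hid := hD σ t0 hφ
  have hpp : t p = p := hid p
  have h1 := ht' p a
  have h2 := (he p (t p) (hcode p)).2.2 rfl hpp
  have h3 : t a.1 = b.1 := h1.trans h2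
  exact hne (Subtype.ext ((hid a.1).symm.trans h3))

end PTsec

lemma exists_PT {V : Type*} (G : SimpleGraph V) (hG : G.IsTree) (r : V) :
    ∃ P : PT r, (∀ x y, G.Adj x y ↔ x ≠ y ∧ (P.par x = y ∨ P.par y = x)) ∧
      ∀ x, P.d x = G.dist x r := by
  have ex : ∀ x, ∃ y, (x = r → y = r) ∧
      (x ≠ r → G.Adj x y ∧ G.dist x r = G.dist y r + 1) := by
    intro x
    by_cases hx : x = r
    · exact ⟨r, fun _ => rfl, fun h => absurd hx h⟩
    · obtain ⟨p, hp⟩ := hG.connected.exists_walk_length_eq_dist x r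
      cases p with
      | nil => exact absurd rfl hx
      | @cons _ y _ h q =>
        refine ⟨y, fun h => absurd h hx, fun _ => ⟨h, ?_⟩⟩
        rw [SimpleGraph.Walk.length_cons] at hp
        have h1 := SimpleGraph.dist_le q
        have h2 := hG.dist_eq_dist_add_one_of_adj r h
        rw [G.dist_comm (u := r), G.dist_comm (u := r)] at h2
        omega
  choose par h0 h1 using ex
  have uniq : ∀ x y z, G.Adj x y → G.Adj x z → G.dist x r = G.dist y r + 1 →
      G.dist x r = G.dist z r + 1 → y = z := by
    intro x y z hy hz dy dz
    obtain ⟨p, hp⟩ := hG.connected.exists_walk_length_eq_dist y r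
    obtain ⟨q, hq⟩ := hG.connected.exists_walk_length_eq_dist z r
    have hp' := (SimpleGraph.Walk.cons hy p).isPath_of_length_eq_dist
      (by rw [SimpleGraph.Walk.length_cons]; omega)
    have hq' := (SimpleGraph.Walk.cons hz q).isPath_of_length_eq_dist
      (by rw [SimpleGraph.Walk.length_cons]; omega)
    have := (hG.existsUnique_path x r).unique hp' hq'
    have := congrArg SimpleGraph.Walk.snd this
    simpa using this
  have hne : ∀ x y, G.Adj x y → G.dist x r = G.dist y r + 1 → par x = y := by
    intro x y hxy hd
    have hx : x ≠ r := by
      rintro rfl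
      simp at hd
    exact uniq x _ _ (h1 x hx).1 hxy (h1 x hx).2 hd
  refine ⟨⟨par, fun x => G.dist x r, h0 r rfl, fun x hx => (h1 x hx).2⟩, ?_, fun _ => rfl⟩
  intro x y
  show G.Adj x y ↔ x ≠ y ∧ (par x = y ∨ par y = x)
  constructor
  · intro h
    refine ⟨h.ne, ?_⟩
    have h2 := hG.dist_eq_dist_add_one_of_adj r h
    rw [G.dist_comm (u := r), G.dist_comm (u := r)] at h2
    rcases h2 with h2 | h2
    · exact Or.inl (hne _ _ h h2)
    · exact Or.inr (hne _ _ h.symm h2)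
  · rintro ⟨hxy, rfl | rfl⟩
    · by_cases hx : x = r
      · exact absurd (hx.trans (h0 x hx).symm) hxy
      · exact (h1 x hx).1
    · by_cases hx : y = r
      · exact absurd ((h0 y hx).trans hx.symm) hxy
      · exact (h1 y hx).1.symm

lemma Distinguishes.comp_inj {V α β : Type*} {G : SimpleGraph V} {r : V} {φ : V → α}
    (h : Distinguishes G r φ) (f : α → β) (hf : Function.Injective f) :
    Distinguishes G r (fun v => f (φ v)) :=
  fun σ hσ hw => h σ hσ (fun w => hf (hw w))

end Aux

theorem stmt7 {V : Type*} [Fintype V] (G : SimpleGraph V) (hG : G.IsTree)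
    (r : V) : DListNum G r = DNum G r := by
  unfold DListNum DNum
  congr 1
  ext k
  simp only [Set.mem_ofPred_eq]
  constructor
  · intro h
    obtain ⟨φ, hφ, hD⟩ := h (fun _ => Finset.range k) (fun _ => Finset.card_range k)
    refine ⟨fun v => ⟨φ v, Finset.mem_range.1 (hφ v)⟩, fun σ hσ hw => hD σ hσ fun w => ?_⟩
    exact congrArg Fin.val (hw w)
  · rintro ⟨φ, hD⟩ L hL
    obtain ⟨P, hadj, hd⟩ := exists_PT G hG r
    have hg := P.dist_good G hadj _ (hD.comp_inj Fin.val Fin.val_injective)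
    have hm := P.code_mem (fun _ => Finset.range k) _
      (fun v => Finset.mem_range.2 (φ v).2) hg r
    have hle := P.C_le (Finset.range k) L (fun v => by rw [hL, Finset.card_range]) r
    have hpos : 0 < (P.C L r).card := lt_of_lt_of_le (Finset.card_pos.2 ⟨_, hm⟩) hle
    obtain ⟨c, hc⟩ := Finset.card_pos.1 hpos
    obtain ⟨ψ, h1, h2⟩ := P.exists_good L c hc
    exact ⟨ψ, h1, P.good_dist G hadj hG.connected hd ψ h2⟩
end
end

section
/- For every tree T (unrooted), the list distinguishing number equals the distinguishing number: D_ℓ(T) = D(T). -/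
open SimpleGraph

noncomputable section

open Classical in
def dcols {V : Type*} [Fintype V] (G : SimpleGraph V) (r : V) (L : V → Finset ℕ) :
    Finset (V → ℕ) :=
  (Fintype.piFinset L).filter (fun f => Distinguishes G r f)

lemma mem_dcols {V : Type*} [Fintype V] (G : SimpleGraph V) (r : V) (L : V → Finset ℕ)
    (f : V → ℕ) : f ∈ dcols G r L ↔ (∀ v, f v ∈ L v) ∧ Distinguishes G r f := by
  classical
  simp [dcols]

def PGood {V : Type*} [Fintype V] (G : SimpleGraph V) (r : V) : Prop :=
  ∀ (k : ℕ) (L : V → Finset ℕ), (∀ v, (L v).card = k) →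
    (dcols G r (fun _ => Finset.range k)).card ≤ (dcols G r L).card

def glue {A B : Type*} (S : SimpleGraph A) (s : A) (T : SimpleGraph B) (r : B) :
    SimpleGraph (A ⊕ B) where
  Adj p q := match p, q with
    | Sum.inl x, Sum.inl y => S.Adj x y
    | Sum.inr x, Sum.inr y => T.Adj x y
    | Sum.inl x, Sum.inr y => x = s ∧ y = r
    | Sum.inr y, Sum.inl x => x = s ∧ y = r
  symm := ⟨by
    rintro (x | x) (y | y) h
    · exact SimpleGraph.Adj.symm (G := S) h
    · exact h
    · exact h
    · exact SimpleGraph.Adj.symm (G := T) h⟩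
  loopless := ⟨by
    rintro (x | x) h
    · exact S.irrefl h
    · exact T.irrefl h⟩

section
variable {A B : Type*} (S : SimpleGraph A) (s : A) (T : SimpleGraph B) (r : B)

@[simp] lemma glue_ll (x y : A) : (glue S s T r).Adj (Sum.inl x) (Sum.inl y) ↔ S.Adj x y := Iff.rfl
@[simp] lemma glue_rr (x y : B) : (glue S s T r).Adj (Sum.inr x) (Sum.inr y) ↔ T.Adj x y := Iff.rfl
@[simp] lemma glue_lr (x : A) (y : B) :
    (glue S s T r).Adj (Sum.inl x) (Sum.inr y) ↔ (x = s ∧ y = r) := Iff.rfl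
@[simp] lemma glue_rl (x : A) (y : B) :
    (glue S s T r).Adj (Sum.inr y) (Sum.inl x) ↔ (x = s ∧ y = r) := Iff.rfl

structure IsEmb (π : A → B) : Prop where
  inj : Function.Injective π
  adj : ∀ x y, T.Adj (π x) (π y) ↔ S.Adj x y
  ne : ∀ x, π x ≠ r
  out : ∀ x y, (∀ z, π z ≠ y) → (T.Adj (π x) y ↔ (x = s ∧ y = r))
end

/-- An injective adjacency-preserving self-map of a finite vertex set is an automorphism. -/
lemma exists_iso {V : Type*} [Finite V] (G : SimpleGraph V) (f : V → V)
    (hf : Function.Injective f) (h : ∀ x y, G.Adj (f x) (f y) ↔ G.Adj x y) :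
    ∃ σ : G ≃g G, ∀ x, σ x = f x := by
  refine ⟨⟨Equiv.ofBijective f (Finite.injective_iff_bijective.1 hf), ?_⟩, fun x => rfl⟩
  intro a b
  exact h a b

lemma closed_all {A : Type*} (S : SimpleGraph A) (hS : S.Connected) (p : A → Prop)
    (h : ∀ x y, S.Adj x y → p x → p y) (x₀ : A) (h₀ : p x₀) : ∀ x, p x := by
  intro x
  obtain ⟨w⟩ := hS.preconnected x₀ x
  induction w with
  | nil => exact h₀
  | cons hadj _ ih => exact ih (h _ _ hadj h₀)

lemma emb_range {A B : Type*} {S : SimpleGraph A} {s : A} {T : SimpleGraph B} {r : B}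
    (hS : S.Connected) {π π' : A → B} (h : IsEmb S s T r π) (h' : IsEmb S s T r π')
    (x₀ y₀ : A) (h₀ : π x₀ = π' y₀) : ∀ x, ∃ z, π' z = π x := by
  refine closed_all S hS (fun x => ∃ z, π' z = π x) ?_ x₀ ⟨y₀, h₀.symm⟩
  rintro x y hxy ⟨z, hz⟩
  by_contra hc
  push Not at hc
  have := (h'.out z (π y) hc).1 (by rw [hz]; exact (h.adj x y).2 hxy)
  exact h.ne y this.2

lemma emb_inj {A B α : Type*} [Finite B] {S : SimpleGraph A} {s : A} {T : SimpleGraph B} {r : B}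
    (hS : S.Connected) {φ : B → α} (hφ : Distinguishes T r φ)
    {π π' : A → B} (h : IsEmb S s T r π) (h' : IsEmb S s T r π')
    (hc : ∀ x, φ (π x) = φ (π' x)) : π = π' := by
  classical
  obtain ⟨i1, a1, n1, o1⟩ := id h
  obtain ⟨i2, a2, n2, o2⟩ := id h'
  suffices hs : ∃ f : B → B, Function.Injective f ∧ (∀ x y, T.Adj (f x) (f y) ↔ T.Adj x y) ∧
      f r = r ∧ (∀ w, φ (f w) = φ w) ∧ ∀ x, f (π x) = π' x by
    obtain ⟨f, hf, ha, hr, hp, hx⟩ := hs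
    obtain ⟨σ, hσ⟩ := exists_iso T f hf ha
    have := hφ σ (by rw [hσ, hr]) (fun w => by rw [hσ, hp])
    funext x
    rw [← hx, ← hσ, this]
  have key : ∀ (ρ : A → B) (hρ : IsEmb S s T r ρ), ∃ g : B → Option A,
      (∀ x, g (ρ x) = some x) ∧ (∀ y x, g y = some x → ρ x = y) := by
    intro ρ hρ
    refine ⟨fun y => if hy : ∃ x, ρ x = y then some hy.choose else none, ?_, ?_⟩
    · intro x
      have hy : ∃ z, ρ z = ρ x := ⟨x, rfl⟩
      simp only [hy, dite_true]
      exact congrArg some (hρ.inj hy.choose_spec)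
    · intro y x hg
      by_cases hy : ∃ x, ρ x = y
      · simp only [hy, dite_true, Option.some.injEq] at hg
        rw [← hg]; exact hy.choose_spec
      · simp [hy] at hg
  have cls1 : ∀ y, (∃ x, π x = y) ∨ ∀ x, π x ≠ y := fun y => by
    by_cases hy : ∃ x, π x = y
    · exact Or.inl hy
    · exact Or.inr (fun x hx => hy ⟨x, hx⟩)
  have cls2 : ∀ y, (∃ x, π' x = y) ∨ ∀ x, π' x ≠ y := fun y => by
    by_cases hy : ∃ x, π' x = y
    · exact Or.inl hy
    · exact Or.inr (fun x hx => hy ⟨x, hx⟩)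
  obtain ⟨g, hg1, hg2⟩ := key π h
  obtain ⟨g', hg1', hg2'⟩ := key π' h'
  have gn : ∀ y, (∀ x, π x ≠ y) → g y = none := fun y hy => by
    rcases hgy : g y with _ | x
    · rfl
    · exact absurd (hg2 y x hgy) (hy x)
  have gn' : ∀ y, (∀ x, π' x ≠ y) → g' y = none := fun y hy => by
    rcases hgy : g' y with _ | x
    · rfl
    · exact absurd (hg2' y x hgy) (hy x)
  by_cases hm : ∃ x₀ y₀, π x₀ = π' y₀
  · obtain ⟨x₀, y₀, h₀⟩ := hm
    have r1 := emb_range hS h h' x₀ y₀ h₀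
    have r2 := emb_range hS h' h y₀ x₀ h₀.symm
    have nn : ∀ y, (∀ x, π x ≠ y) → ∀ x, π' x ≠ y := fun y hy x hx => by
      obtain ⟨z, hz⟩ := r2 x
      exact hy z (hz.trans hx)
    have f1 : ∀ x, (fun y => (g y).elim y π') (π x) = π' x := fun x => by simp [hg1]
    have f2 : ∀ y, (∀ x, π x ≠ y) → (fun y => (g y).elim y π') y = y := fun y hy => by
      simp [gn y hy]
    generalize (fun y => (g y).elim y π') = f at f1 f2
    refine ⟨f, ?_, ?_, f2 r n1, ?_, f1⟩
    · intro x y hxy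
      rcases cls1 x with ⟨x, rfl⟩ | hx <;> rcases cls1 y with ⟨y, rfl⟩ | hy
      · rw [f1, f1] at hxy; rw [i2 hxy]
      · rw [f1, f2 y hy] at hxy; exact absurd hxy (nn y hy x)
      · rw [f1, f2 x hx] at hxy; exact absurd hxy.symm (nn x hx y)
      · rwa [f2 x hx, f2 y hy] at hxy
    · intro x y
      rcases cls1 x with ⟨x, rfl⟩ | hx <;> rcases cls1 y with ⟨y, rfl⟩ | hy
      · rw [f1, f1, a1, a2]
      · rw [f1, f2 y hy, o1 x y hy, o2 x y (nn y hy)]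
      · rw [f1, f2 x hx, T.adj_comm, T.adj_comm x, o1 y x hx, o2 y x (nn x hx)]
      · rw [f2 x hx, f2 y hy]
    · intro x
      rcases cls1 x with ⟨x, rfl⟩ | hx
      · rw [f1, hc]
      · rw [f2 x hx]
  · push Not at hm
    have f1 : ∀ x, (fun y => (g y).elim ((g' y).elim y π) π') (π x) = π' x :=
      fun x => by simp [hg1]
    have f2 : ∀ x, (fun y => (g y).elim ((g' y).elim y π) π') (π' x) = π x :=
      fun x => by simp [hg1', gn (π' x) (fun z => hm z x)]
    have f3 : ∀ y, (∀ x, π x ≠ y) → (∀ x, π' x ≠ y) →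
        (fun y => (g y).elim ((g' y).elim y π) π') y = y := fun y hy hy' => by
      simp [gn y hy, gn' y hy']
    generalize (fun y => (g y).elim ((g' y).elim y π) π') = f at f1 f2 f3
    have cls : ∀ y, (∃ x, π x = y) ∨ (∃ x, π' x = y) ∨ ((∀ x, π x ≠ y) ∧ ∀ x, π' x ≠ y) := by
      intro y
      rcases cls1 y with hy | hy
      · exact Or.inl hy
      · rcases cls2 y with hy' | hy'
        · exact Or.inr (Or.inl hy')
        · exact Or.inr (Or.inr ⟨hy, hy'⟩)
    have ff : ∀ y, f (f y) = y := by
      intro y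
      rcases cls y with ⟨x, rfl⟩ | ⟨x, rfl⟩ | ⟨hy, hy'⟩
      · rw [f1, f2]
      · rw [f2, f1]
      · rw [f3 y hy hy', f3 y hy hy']
    have no : ∀ x y, ¬ T.Adj (π x) (π' y) := fun x y hxy =>
      n2 y ((o1 x (π' y) (fun z => hm z y)).1 hxy).2
    refine ⟨f, ?_, ?_, f3 r n1 n2, ?_, f1⟩
    · intro x y hxy
      rw [← ff x, hxy, ff]
    · intro x y
      rcases cls x with ⟨x, rfl⟩ | ⟨x, rfl⟩ | ⟨hx, hx'⟩ <;>
        rcases cls y with ⟨y, rfl⟩ | ⟨y, rfl⟩ | ⟨hy, hy'⟩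
      · rw [f1, f1, a1, a2]
      · rw [f1, f2, T.adj_comm]; simp [no]
      · rw [f1, f3 y hy hy', o1 x y hy, o2 x y hy']
      · rw [f1, f2, T.adj_comm (π' x)]; simp [no]
      · rw [f2, f2, a1, a2]
      · rw [f2, f3 y hy hy', o1 x y hy, o2 x y hy']
      · rw [f1, f3 x hx hx', T.adj_comm, T.adj_comm x, o1 y x hx, o2 y x hx']
      · rw [f2, f3 x hx hx', T.adj_comm, T.adj_comm x, o1 y x hx, o2 y x hx']
      · rw [f3 x hx hx', f3 y hy hy']
    · intro x
      rcases cls x with ⟨x, rfl⟩ | ⟨x, rfl⟩ | ⟨hx, hx'⟩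
      · rw [f1, hc]
      · rw [f2, hc]
      · rw [f3 x hx hx']

lemma IsEmb.comp {A B : Type*} {S : SimpleGraph A} {s : A} {T : SimpleGraph B} {r : B}
    {π : A → B} (h : IsEmb S s T r π) (σ : S ≃g S) (hσ : σ s = s) :
    IsEmb S s T r (fun x => π (σ x)) where
  inj := h.inj.comp σ.injective
  adj x y := by rw [h.adj, σ.map_adj_iff]
  ne x := h.ne _
  out x y hy := by
    rw [h.out (σ x) y (fun z => by have := hy (σ.symm z); simpa using this)]
    constructor
    · rintro ⟨h1, h2⟩
      exact ⟨σ.injective (h1.trans hσ.symm), h2⟩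
    · rintro ⟨rfl, h2⟩
      exact ⟨hσ, h2⟩

lemma emb_inl {A B : Type*} (S : SimpleGraph A) (s : A) (T : SimpleGraph B) (r : B) :
    IsEmb S s (glue S s T r) (Sum.inr r) Sum.inl where
  inj := Sum.inl_injective
  adj x y := Iff.rfl
  ne x := by simp
  out x y hy := by
    rcases y with y | y
    · exact absurd rfl (hy y)
    · simp

lemma emb_inr {A B : Type*} {S : SimpleGraph A} {s : A} {T : SimpleGraph B} {r : B}
    {π : A → B} (h : IsEmb S s T r π) :
    IsEmb S s (glue S s T r) (Sum.inr r) (fun x => Sum.inr (π x)) where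
  inj := Sum.inr_injective.comp h.inj
  adj x y := by simpa using h.adj x y
  ne x := by simpa using h.ne x
  out x y hy := by
    rcases y with y | y
    · simpa using fun _ => h.ne x
    · simpa using h.out x y (fun z hz => hy z (by rw [hz]))

lemma glue_fix {A B α : Type*} [Finite A] [Finite B] {S : SimpleGraph A} {s : A}
    {T : SimpleGraph B} {r : B} {f : A ⊕ B → α}
    (h1 : Distinguishes S s (fun x => f (Sum.inl x)))
    (h2 : Distinguishes T r (fun x => f (Sum.inr x)))
    (σ : glue S s T r ≃g glue S s T r) (hr : σ (Sum.inr r) = Sum.inr r)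
    (hall : ∀ x, ∃ y, σ (Sum.inl x) = Sum.inl y)
    (hf : ∀ w, f (σ w) = f w) : ∀ w, σ w = w := by
  choose g hg using hall
  have gi : Function.Injective g := fun x y hxy => by
    have : σ (Sum.inl x) = σ (Sum.inl y) := by rw [hg, hg, hxy]
    exact Sum.inl_injective (σ.injective this)
  have gb : Function.Bijective g := Finite.injective_iff_bijective.1 gi
  have hall' : ∀ y, ∃ z, σ (Sum.inr y) = Sum.inr z := by
    intro y
    rcases hy : σ (Sum.inr y) with x | z
    · obtain ⟨x, rfl⟩ := gb.2 x
      rw [← hg] at hy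
      exact absurd (σ.injective hy) (by simp)
    · exact ⟨z, rfl⟩
  choose k hk using hall'
  have ki : Function.Injective k := fun x y hxy => by
    have : σ (Sum.inr x) = σ (Sum.inr y) := by rw [hk, hk, hxy]
    exact Sum.inr_injective (σ.injective this)
  have gs : g s = s := by
    have : (glue S s T r).Adj (σ (Sum.inl s)) (σ (Sum.inr r)) := by
      rw [σ.map_adj_iff]; simp
    rw [hr, hg] at this
    exact this.1
  have kr : k r = r := by
    rw [hk] at hr; exact Sum.inr_injective hr
  obtain ⟨τ, hτ⟩ := exists_iso S g gi (fun x y => by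
    rw [← glue_ll S s T r, ← glue_ll S s T r, ← hg, ← hg, σ.map_adj_iff])
  obtain ⟨ρ, hρ⟩ := exists_iso T k ki (fun x y => by
    rw [← glue_rr S s T r, ← glue_rr S s T r, ← hk, ← hk, σ.map_adj_iff])
  have e1 := h1 τ (by rw [hτ, gs]) (fun w => by
    show f (Sum.inl (τ w)) = f (Sum.inl w)
    rw [hτ, ← hg, hf])
  have e2 := h2 ρ (by rw [hρ, kr]) (fun w => by
    show f (Sum.inr (ρ w)) = f (Sum.inr w)
    rw [hρ, ← hk, hf])
  rintro (w | w)
  · rw [hg, ← hτ, e1]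
  · rw [hk, ← hρ, e2]

lemma glue_right {A B α : Type*} {S : SimpleGraph A} {s : A}
    {T : SimpleGraph B} {r : B} {f : A ⊕ B → α}
    (h : Distinguishes (glue S s T r) (Sum.inr r) f) :
    Distinguishes T r (fun x => f (Sum.inr x)) := by
  intro σ hσ hf w
  let τ : glue S s T r ≃g glue S s T r :=
    ⟨Equiv.sumCongr (Equiv.refl A) σ.toEquiv, by
      have key : ∀ y, σ y = r ↔ y = r := fun y =>
        ⟨fun hy => σ.injective (hy.trans hσ.symm), fun hy => hy ▸ hσ⟩
      rintro (x | x) (y | y)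
      · simp
      · simp [key]
      · simp [key]
      · simpa using σ.map_adj_iff⟩
  have := h τ (by simp [τ, hσ]) (by
    rintro (w | w)
    · simp [τ]
    · simpa [τ] using hf w) (Sum.inr w)
  simpa [τ] using this

lemma glue_dist_iff {A B α : Type*} [Finite A] [Finite B] {S : SimpleGraph A} {s : A}
    {T : SimpleGraph B} {r : B} (hS : S.Connected) (f : A ⊕ B → α) :
    Distinguishes (glue S s T r) (Sum.inr r) f ↔
      Distinguishes S s (fun x => f (Sum.inl x)) ∧ Distinguishes T r (fun x => f (Sum.inr x)) ∧
      ∀ π, IsEmb S s T r π → (fun x => f (Sum.inl x)) ≠ fun x => f (Sum.inr (π x)) := by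
  constructor
  · intro h
    refine ⟨?_, glue_right h, ?_⟩
    · intro σ hσ hf w
      have := emb_inj hS h ((emb_inl S s T r).comp σ hσ) (emb_inl S s T r) hf
      exact Sum.inl_injective (congrFun this w)
    · intro π hπ hc
      have := emb_inj hS h (emb_inl S s T r) (emb_inr hπ) (fun x => congrFun hc x)
      exact absurd (congrFun this s) (by simp)
  · rintro ⟨h1, h2, h3⟩ σ hσ hf
    by_cases hx : ∃ x₀ y₀, σ (Sum.inl x₀) = Sum.inl y₀
    · obtain ⟨x₀, hx₀⟩ := hx
      refine glue_fix h1 h2 σ hσ ?_ hf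
      refine closed_all S hS (fun x => ∃ y, σ (Sum.inl x) = Sum.inl y) ?_ x₀ hx₀
      rintro x x' hxx ⟨y, hy⟩
      rcases hy' : σ (Sum.inl x') with z | z
      · exact ⟨z, rfl⟩
      · have : (glue S s T r).Adj (σ (Sum.inl x)) (σ (Sum.inl x')) := by
          rw [σ.map_adj_iff]; exact hxx
        rw [hy, hy'] at this
        rw [this.2, ← hσ] at hy'
        exact absurd (σ.injective hy') (by simp)
    · push Not at hx
      have : ∀ x, ∃ y, σ (Sum.inl x) = Sum.inr y := by
        intro x
        rcases hy : σ (Sum.inl x) with z | z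
        · exact absurd hy (hx x z)
        · exact ⟨z, rfl⟩
      choose π hπ using this
      refine absurd ?_ (h3 π ⟨?_, ?_, ?_, ?_⟩)
      · funext x
        rw [← hπ, hf]
      · intro x y hxy
        have : σ (Sum.inl x) = σ (Sum.inl y) := by rw [hπ, hπ, hxy]
        exact Sum.inl_injective (σ.injective this)
      · intro x y
        rw [← glue_rr S s T r, ← hπ, ← hπ, σ.map_adj_iff, glue_ll]
      · rintro x rfl
        rw [← hπ x] at hσ
        exact absurd (σ.injective hσ) (hx x x)
      · intro x y hy
        obtain ⟨z, hz⟩ := σ.surjective (Sum.inr y)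
        rcases z with z | z
        · rw [hπ] at hz
          exact absurd (Sum.inr_injective hz) (hy z)
        · rw [← glue_rr S s T r, ← hπ, ← hz, σ.map_adj_iff, glue_lr]
          refine and_congr_right fun _ => ⟨?_, ?_⟩
          · rintro rfl
            rw [hσ] at hz
            exact (Sum.inr_injective hz).symm
          · rintro rfl
            exact Sum.inr_injective (σ.injective (hz.trans hσ.symm))

open Classical in
def embs {A B : Type*} [Fintype A] [Fintype B] (S : SimpleGraph A) (s : A) (T : SimpleGraph B)
    (r : B) : Finset (A → B) := Finset.univ.filter (fun π => IsEmb S s T r π)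

lemma mem_embs {A B : Type*} [Fintype A] [Fintype B] (S : SimpleGraph A) (s : A)
    (T : SimpleGraph B) (r : B) (π : A → B) : π ∈ embs S s T r ↔ IsEmb S s T r π := by
  simp [embs]

open Classical in
lemma card_glue {A B : Type*} [Fintype A] [Fintype B] {S : SimpleGraph A} {s : A}
    {T : SimpleGraph B} {r : B} (hS : S.Connected) (L : A ⊕ B → Finset ℕ) :
    (dcols (glue S s T r) (Sum.inr r) L).card =
      ∑ g ∈ dcols T r (fun y => L (Sum.inr y)),
        ((dcols S s (fun x => L (Sum.inl x))) \
          ((embs S s T r).image (fun π x => g (π x)))).card := by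
  rw [← Finset.card_sigma]
  refine Finset.card_nbij' (fun f => ⟨fun y => f (Sum.inr y), fun x => f (Sum.inl x)⟩)
    (fun p => Sum.elim p.2 p.1) ?_ ?_ ?_ ?_
  · intro f hf
    simp only [Finset.mem_coe, mem_dcols, glue_dist_iff hS] at hf
    obtain ⟨h0, h1, h2, h3⟩ := hf
    simp only [Finset.mem_coe, Finset.mem_sigma, mem_dcols, Finset.mem_sdiff, Finset.mem_image,
      mem_embs]
    refine ⟨⟨fun v => h0 _, h2⟩, ⟨fun v => h0 _, h1⟩, ?_⟩
    rintro ⟨π, hπ, he⟩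
    exact h3 π hπ he.symm
  · rintro ⟨g, f⟩ hf
    simp only [Finset.mem_coe, Finset.mem_sigma, mem_dcols, Finset.mem_sdiff, Finset.mem_image,
      mem_embs] at hf
    obtain ⟨⟨a1, a2⟩, ⟨b1, b2⟩, b3⟩ := hf
    simp only [Finset.mem_coe, mem_dcols, glue_dist_iff hS]
    refine ⟨?_, b2, a2, fun π hπ he => b3 ⟨π, hπ, he.symm⟩⟩
    rintro (v | v)
    · exact b1 v
    · exact a1 v
  · intro f _
    funext v
    rcases v with v | v <;> rfl
  · rintro ⟨g, f⟩ _
    rfl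

lemma good_glue {A B : Type*} [Fintype A] [Fintype B] {S : SimpleGraph A} {s : A}
    {T : SimpleGraph B} {r : B} (hS : S.Connected) (h1 : PGood S s) (h2 : PGood T r) :
    PGood (glue S s T r) (Sum.inr r) := by
  classical
  intro k L hL
  rw [card_glue hS, card_glue hS]
  have e1 := h1 k (fun x => L (Sum.inl x)) (fun v => hL _)
  have e2 := h2 k (fun x => L (Sum.inr x)) (fun v => hL _)
  calc _ = ∑ g ∈ dcols T r (fun _ => Finset.range k),
        ((dcols S s (fun _ => Finset.range k)).card - (embs S s T r).card) := by
        refine Finset.sum_congr rfl fun g hg => ?_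
        rw [mem_dcols] at hg
        have inj : ∀ π, IsEmb S s T r π → ∀ π', IsEmb S s T r π' →
            (fun x => g (π x)) = (fun x => g (π' x)) → π = π' := fun π hπ π' hπ' he =>
          emb_inj hS hg.2 hπ hπ' (fun x => congrFun he x)
        rw [Finset.card_sdiff_of_subset, Finset.card_image_of_injOn]
        · intro π hπ π' hπ' he
          exact inj π ((mem_embs _ _ _ _ _).1 hπ) π' ((mem_embs _ _ _ _ _).1 hπ') he
        · intro f hf
          obtain ⟨π, hπ, rfl⟩ := Finset.mem_image.1 hf
          rw [mem_embs] at hπ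
          rw [mem_dcols]
          refine ⟨fun v => hg.1 _, fun σ hσ hc w => ?_⟩
          have := inj _ (hπ.comp σ hσ) π hπ (funext hc)
          exact hπ.inj (congrFun this w)
    _ ≤ ∑ g ∈ dcols T r (fun x => L (Sum.inr x)),
        ((dcols S s (fun x => L (Sum.inl x))).card - (embs S s T r).card) := by
        rw [Finset.sum_const, Finset.sum_const]
        exact Nat.mul_le_mul e2 (by omega)
    _ ≤ _ := by
        refine Finset.sum_le_sum fun g hg => ?_
        refine le_trans ?_ (Finset.le_card_sdiff _ _)
        have := Finset.card_image_le (s := embs S s T r) (f := fun π x => g (π x))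
        omega

lemma dist_iso {V W α : Type*} {G : SimpleGraph V} {H : SimpleGraph W} (e : G ≃g H) (r : V)
    (f : W → α) (h : Distinguishes H (e r) f) : Distinguishes G r (fun x => f (e x)) := by
  intro σ hσ hf w
  have := h ((e.symm.trans σ).trans e) (by simp [hσ]) (fun w => by simpa using hf (e.symm w)) (e w)
  simpa using this

lemma distU_iso {V W α : Type*} {G : SimpleGraph V} {H : SimpleGraph W} (e : G ≃g H)
    (f : W → α) (h : DistinguishesU H f) : DistinguishesU G (fun x => f (e x)) := by
  intro σ hf w
  have := h ((e.symm.trans σ).trans e) (fun w => by simpa using hf (e.symm w)) (e w)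
  simpa using this

lemma card_iso {V W : Type*} [Fintype V] [Fintype W] {G : SimpleGraph V} {H : SimpleGraph W}
    (e : G ≃g H) (r : V) (L : V → Finset ℕ) :
    (dcols G r L).card = (dcols H (e r) (fun w => L (e.symm w))).card := by
  refine Finset.card_nbij' (fun f w => f (e.symm w)) (fun f v => f (e v)) ?_ ?_ ?_ ?_
  · intro f hf
    simp only [Finset.mem_coe, mem_dcols] at hf ⊢
    refine ⟨fun v => hf.1 _, dist_iso e.symm (e r) f ?_⟩
    simpa using hf.2
  · intro f hf
    simp only [Finset.mem_coe, mem_dcols] at hf ⊢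
    exact ⟨fun v => by simpa using hf.1 (e v), dist_iso e r f hf.2⟩
  · intro f _
    simp
  · intro f _
    simp

lemma good_iso {V W : Type*} [Fintype V] [Fintype W] {G : SimpleGraph V} {H : SimpleGraph W}
    (e : G ≃g H) (r : V) (h : PGood H (e r)) : PGood G r := by
  intro k L hL
  rw [card_iso e, card_iso e]
  exact h k _ (fun v => hL _)

lemma glue_edge {A B : Type*} [Fintype A] [Fintype B] {S : SimpleGraph A} {s : A}
    {T : SimpleGraph B} {r : B} (hS : S.Connected) (hT : T.Connected)
    (h1 : PGood S s) (h2 : PGood T r)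
    (hinv : ∀ σ : glue S s T r ≃g glue S s T r,
      (σ (Sum.inl s) = Sum.inl s ∧ σ (Sum.inr r) = Sum.inr r) ∨
      (σ (Sum.inl s) = Sum.inr r ∧ σ (Sum.inr r) = Sum.inl s))
    (k : ℕ) (L : A ⊕ B → Finset ℕ) (hL : ∀ v, (L v).card = k)
    (f : A ⊕ B → ℕ) (hfk : ∀ v, f v ∈ Finset.range k)
    (hf : DistinguishesU (glue S s T r) f) :
    ∃ φ : A ⊕ B → ℕ, (∀ v, φ v ∈ L v) ∧ DistinguishesU (glue S s T r) φ := by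
  classical
  have hfr : Distinguishes (glue S s T r) (Sum.inr r) f := fun σ _ h => hf σ h
  obtain ⟨f1, f2, -⟩ := (glue_dist_iff hS f).1 hfr
  let I : Finset (A → B) := Finset.univ.filter (fun π => ∃ ι : S ≃g T, ι s = r ∧ π = ι)
  have hI : ∀ π, π ∈ I ↔ ∃ ι : S ≃g T, ι s = r ∧ π = ι := fun π => by simp [I]
  have e1 := h1 k (fun x => L (Sum.inl x)) (fun v => hL _)
  have e2 := h2 k (fun x => L (Sum.inr x)) (fun v => hL _)
  have c1 : (fun x => f (Sum.inl x)) ∈ dcols S s (fun _ => Finset.range k) :=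
    (mem_dcols _ _ _ _).2 ⟨fun v => hfk _, f1⟩
  have c2 : (fun x => f (Sum.inr x)) ∈ dcols T r (fun _ => Finset.range k) :=
    (mem_dcols _ _ _ _).2 ⟨fun v => hfk _, f2⟩
  have lt : I.card < (dcols S s (fun _ => Finset.range k)).card := by
    rw [← Finset.card_image_of_injOn (s := I) (f := fun π x => f (Sum.inr (π x)))]
    · refine Finset.card_lt_card (Finset.ssubset_iff_subset_ne.2 ⟨?_, ?_⟩)
      · intro g hg
        obtain ⟨π, hπ, rfl⟩ := Finset.mem_image.1 hg
        obtain ⟨ι, hι, rfl⟩ := (hI π).1 hπ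
        refine (mem_dcols _ _ _ _).2 ⟨fun v => hfk _, ?_⟩
        exact dist_iso ι s (fun x => f (Sum.inr x)) (hι ▸ f2)
      · intro he
        rw [← he] at c1
        obtain ⟨π, hπ, hc⟩ := Finset.mem_image.1 c1
        obtain ⟨ι, hι, rfl⟩ := (hI π).1 hπ
        let τ : glue S s T r ≃g glue S s T r :=
          ⟨(Equiv.sumCongr ι.toEquiv ι.symm.toEquiv).trans (Equiv.sumComm B A), by
            have key : ∀ x, ι x = r ↔ x = s := fun x =>
              ⟨fun hy => ι.injective (hy.trans hι.symm), fun hy => hy ▸ hι⟩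
            have key' : ∀ x, ι.symm x = s ↔ x = r := fun x => by
              rw [← key]; simp
            rintro (x | x) (y | y)
            · simpa using ι.map_adj_iff
            · have := key x; have := key' y; simp_all [and_comm]
            · have := key y; have := key' x; simp_all [and_comm]
            · simpa using ι.symm.map_adj_iff⟩
        have := hf τ (by
          rintro (w | w)
          · simpa [τ] using congrFun hc w
          · simpa [τ] using (congrFun hc (ι.symm w)).symm) (Sum.inl s)
        simp [τ] at this
    · intro π hπ π' hπ' he
      obtain ⟨ι, hι, rfl⟩ := (hI π).1 hπ
      obtain ⟨ι', hι', rfl⟩ := (hI π').1 hπ'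
      have hss : ι.symm r = s := by rw [← hι]; simp
      have := f2 (ι.symm.trans ι') (by simp [hss, hι'])
        (fun w => by simpa using (congrFun he (ι.symm w)).symm)
      funext x
      simpa using (this (ι x)).symm
  have pos : 0 < (dcols T r (fun x => L (Sum.inr x))).card :=
    lt_of_lt_of_le (Finset.card_pos.2 ⟨_, c2⟩) e2
  obtain ⟨ψ, hψ⟩ := Finset.card_pos.1 pos
  have : (I.image (fun π x => ψ (π x))).card < (dcols S s (fun x => L (Sum.inl x))).card :=
    lt_of_le_of_lt Finset.card_image_le (lt_of_lt_of_le lt e1)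
  obtain ⟨χ, hχ, hχn⟩ := Finset.exists_mem_notMem_of_card_lt_card this
  rw [mem_dcols] at hψ hχ
  refine ⟨Sum.elim χ ψ, ?_, ?_⟩
  · rintro (v | v)
    · exact hχ.1 v
    · exact hψ.1 v
  intro σ hσ
  have nocross : ∀ (a b : A ⊕ B), (glue S s T r).Adj a b → ¬ (a = Sum.inl s ∧ b = Sum.inr r) →
      ¬ (a = Sum.inr r ∧ b = Sum.inl s) → ((σ a).isLeft ↔ (σ b).isLeft) := by
    intro a b hab n1 n2
    rw [← σ.map_adj_iff] at hab
    have key : ∀ c d : A ⊕ B, σ a = c → σ b = d → (glue S s T r).Adj c d →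
        (c.isLeft ↔ d.isLeft) := by
      rintro (c | c) (d | d) hc hd had
      · simp
      · exfalso
        obtain ⟨rfl, rfl⟩ := had
        rcases hinv σ with ⟨u1, u2⟩ | ⟨u1, u2⟩
        · exact n1 ⟨σ.injective (hc.trans u1.symm), σ.injective (hd.trans u2.symm)⟩
        · exact n2 ⟨σ.injective (hc.trans u2.symm), σ.injective (hd.trans u1.symm)⟩
      · exfalso
        obtain ⟨rfl, rfl⟩ := had
        rcases hinv σ with ⟨u1, u2⟩ | ⟨u1, u2⟩
        · exact n2 ⟨σ.injective (hc.trans u2.symm), σ.injective (hd.trans u1.symm)⟩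
        · exact n1 ⟨σ.injective (hc.trans u1.symm), σ.injective (hd.trans u2.symm)⟩
      · simp
    exact key _ _ rfl rfl hab
  rcases hinv σ with ⟨u1, u2⟩ | ⟨u1, u2⟩
  · refine glue_fix (f := Sum.elim χ ψ) hχ.2 hψ.2 σ u2 ?_ hσ
    intro x
    have : (σ (Sum.inl x)).isLeft := by
      refine closed_all S hS (fun x => (σ (Sum.inl x)).isLeft) ?_ s (by simp [u1]) x
      intro x y hxy hx
      exact (nocross _ _ ((glue_ll S s T r x y).2 hxy) (by simp) (by simp)).1 hx
    exact Sum.isLeft_iff.1 this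
  · exfalso
    have q1 : ∀ x, ∃ y, σ (Sum.inl x) = Sum.inr y := by
      intro x
      have : ¬ (σ (Sum.inl x)).isLeft := by
        refine closed_all S hS (fun x => ¬ (σ (Sum.inl x)).isLeft) ?_ s (by simp [u1]) x
        intro x y hxy hx
        exact fun h => hx
          ((nocross _ _ ((glue_ll S s T r x y).2 hxy) (by simp) (by simp)).2 h)
      rcases h : σ (Sum.inl x) with y | y
      · simp [h] at this
      · exact ⟨y, rfl⟩
    have q2 : ∀ x, ∃ y, σ (Sum.inr x) = Sum.inl y := by
      intro x
      have : (σ (Sum.inr x)).isLeft := by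
        refine closed_all T hT (fun x => (σ (Sum.inr x)).isLeft) ?_ r (by simp [u2]) x
        intro x y hxy hx
        exact (nocross _ _ ((glue_rr S s T r x y).2 hxy) (by simp) (by simp)).1 hx
      exact Sum.isLeft_iff.1 this
    choose π hπ using q1
    have bij : Function.Bijective π := by
      constructor
      · intro x y hxy
        have : σ (Sum.inl x) = σ (Sum.inl y) := by rw [hπ, hπ, hxy]
        exact Sum.inl_injective (σ.injective this)
      · intro y
        obtain ⟨z, hz⟩ := σ.surjective (Sum.inr y)
        rcases z with z | z
        · exact ⟨z, Sum.inr_injective ((hπ z).symm.trans hz)⟩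
        · obtain ⟨w, hw⟩ := q2 z
          rw [hw] at hz
          exact absurd hz (by simp)
    let ι : S ≃g T := ⟨Equiv.ofBijective π bij, by
      intro x y
      show T.Adj (π x) (π y) ↔ S.Adj x y
      rw [← glue_rr S s T r, ← hπ, ← hπ, σ.map_adj_iff, glue_ll]⟩
    refine hχn (Finset.mem_image.2 ⟨π, (hI π).2 ⟨ι, ?_, rfl⟩, ?_⟩)
    · have := (hπ s).symm.trans u1
      exact Sum.inr_injective this
    · funext x
      have := hσ (Sum.inl x)
      rw [hπ] at this
      exact this

lemma induce_conn {V : Type*} {G G' : SimpleGraph V} (hle : G' ≤ G) (A : Set V) (a : V)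
    (ha : a ∈ A) (hcl : ∀ x y, G'.Adj x y → x ∈ A → y ∈ A)
    (hr : ∀ x ∈ A, G'.Reachable a x) : (G.induce A).Connected := by
  have key : ∀ x, ∀ y (w : G'.Walk x y) (hx : x ∈ A), ∃ hy : y ∈ A,
      (G.induce A).Reachable ⟨x, hx⟩ ⟨y, hy⟩ := by
    intro x y w
    induction w with
    | nil => exact fun hx => ⟨hx, SimpleGraph.Reachable.refl _⟩
    | cons hadj _ ih =>
      intro hx
      obtain ⟨hy, h⟩ := ih (hcl _ _ hadj hx)
      refine ⟨hy, SimpleGraph.Reachable.trans (SimpleGraph.Adj.reachable ?_) h⟩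
      exact hle hadj
  have : Nonempty A := ⟨⟨a, ha⟩⟩
  have key2 : ∀ x : A, (G.induce A).Reachable ⟨a, ha⟩ x := by
    rintro ⟨x, hx⟩
    obtain ⟨w⟩ := hr x hx
    exact (key a x w ha).2
  exact ⟨fun x y => (key2 x).symm.trans (key2 y)⟩

lemma tree_side {V : Type*} {G : SimpleGraph V} (hG : G.IsTree) {r s : V} (hrs : G.Adj r s) :
    ∃ A : Set V, s ∈ A ∧ r ∉ A ∧ (∀ u z, u ∉ A → z ∈ A → G.Adj u z → u = r ∧ z = s) ∧
      (G.induce A).Connected ∧ (G.induce Aᶜ).Connected := by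
  have hb : ¬ (G.deleteEdges {s(r, s)}).Reachable r s :=
    isAcyclic_iff_forall_adj_isBridge.1 hG.isAcyclic hrs
  set G' := G.deleteEdges {s(r, s)} with hG'
  have hle : G' ≤ G := SimpleGraph.deleteEdges_le _
  have hadj : ∀ x y, G.Adj x y → G'.Adj x y ∨ (x = r ∧ y = s) ∨ (x = s ∧ y = r) := by
    intro x y hxy
    by_cases h : s(x, y) = s(r, s)
    · right
      simpa using h
    · left
      rw [hG', SimpleGraph.deleteEdges_adj]
      exact ⟨hxy, by simpa using h⟩
  have hall : ∀ x, G'.Reachable s x ∨ G'.Reachable r x := by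
    refine closed_all G hG.connected _ ?_ s (Or.inl (SimpleGraph.Reachable.refl _))
    intro x y hxy hx
    rcases hadj x y hxy with h | ⟨rfl, rfl⟩ | ⟨rfl, rfl⟩
    · exact hx.imp (fun h' => h'.trans h.reachable) (fun h' => h'.trans h.reachable)
    · exact Or.inl (SimpleGraph.Reachable.refl _)
    · exact Or.inr (SimpleGraph.Reachable.refl _)
  refine ⟨{u | G'.Reachable s u}, SimpleGraph.Reachable.refl _, fun h => hb h.symm, ?_, ?_, ?_⟩
  · intro u z hu hz huz
    rcases hadj u z huz with h | h | ⟨rfl, rfl⟩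
    · exact absurd (SimpleGraph.Reachable.trans hz h.symm.reachable) hu
    · exact h
    · exact absurd (SimpleGraph.Reachable.refl _) hu
  · refine induce_conn hle _ s (SimpleGraph.Reachable.refl _) ?_ (fun x hx => hx)
    intro x y hxy hx
    exact SimpleGraph.Reachable.trans hx hxy.reachable
  · refine induce_conn hle _ r (fun h => hb h.symm) ?_ (fun x hx => (hall x).resolve_left hx)
    intro x y hxy hx hy
    exact hx (SimpleGraph.Reachable.trans hy hxy.symm.reachable)

open Classical in
def glueIso {V : Type*} (G : SimpleGraph V) (A : Set V) (r s : V) (hs : s ∈ A) (hr : r ∉ A)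
    (hrs : G.Adj r s)
    (h : ∀ u z, u ∉ A → z ∈ A → G.Adj u z → u = r ∧ z = s) :
    glue (G.induce A) ⟨s, hs⟩ (G.induce Aᶜ) ⟨r, hr⟩ ≃g G where
  toEquiv := Equiv.Set.sumCompl A
  map_rel_iff' := by
    rintro (⟨x, hx⟩ | ⟨x, hx⟩) (⟨y, hy⟩ | ⟨y, hy⟩)
    · simp
    · simp only [Equiv.Set.sumCompl_apply_inl, Equiv.Set.sumCompl_apply_inr, glue_lr,
        Subtype.mk.injEq]
      constructor
      · exact fun hxy => (h y x hy hx hxy.symm).symm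
      · rintro ⟨rfl, rfl⟩
        exact hrs.symm
    · simp only [Equiv.Set.sumCompl_apply_inl, Equiv.Set.sumCompl_apply_inr, glue_rl,
        Subtype.mk.injEq]
      constructor
      · exact fun hxy => (h x y hx hy hxy).symm
      · rintro ⟨rfl, rfl⟩
        exact hrs
    · simp

lemma good_sub {V : Type*} [Fintype V] [Subsingleton V] (G : SimpleGraph V) (r : V) :
    PGood G r := by
  classical
  intro k L hL
  have : ∀ f : V → ℕ, Distinguishes G r f := fun f σ _ _ w => Subsingleton.elim _ _
  simp [dcols, this, Fintype.card_piFinset, hL]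

lemma good_tree (n : ℕ) : ∀ {V : Type*} [Fintype V] (G : SimpleGraph V), G.IsTree →
    Fintype.card V = n → ∀ r : V, PGood G r := by
  classical
  induction n using Nat.strong_induction_on with
  | _ n ih =>
    intro V _ G hG hn r
    by_cases hs : ∃ s, G.Adj r s
    · obtain ⟨s, hrs⟩ := hs
      obtain ⟨A, hsA, hrA, hA, c1, c2⟩ := tree_side hG hrs
      have l1 : Fintype.card A < n := hn ▸ Fintype.card_subtype_lt (x := r) hrA
      have l2 : Fintype.card (Aᶜ : Set V) < n :=
        hn ▸ Fintype.card_subtype_lt (p := (· ∈ Aᶜ)) (x := s) (by simpa using hsA)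
      have g1 := ih _ l1 (G.induce A) ⟨c1, hG.isAcyclic.induce A⟩ rfl ⟨s, hsA⟩
      have g2 := ih _ l2 (G.induce Aᶜ) ⟨c2, hG.isAcyclic.induce _⟩ rfl ⟨r, hrA⟩
      have g := good_glue c1 g1 g2
      have := good_iso (glueIso G A r s hsA hrA hrs hA).symm r
      refine this ?_
      have e : (glueIso G A r s hsA hrA hrs hA).symm r = Sum.inr ⟨r, hrA⟩ := by
        rw [RelIso.symm_apply_eq]; rfl
      rw [e]
      exact g
    · have : Subsingleton V := by
        have : ∀ x, x = r := closed_all G hG.connected (fun x => x = r) (by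
          rintro x y hxy rfl
          exact absurd ⟨y, hxy⟩ hs) r rfl
        exact ⟨fun x y => (this x).trans (this y).symm⟩
      exact good_sub G r

lemma side_dist {V : Type*} {G : SimpleGraph V} (hG : G.Connected) {r s : V} (hrs : G.Adj r s)
    (A : Set V) (hA : ∀ u z, u ∉ A → z ∈ A → G.Adj u z → u = r ∧ z = s)
    {u z : V} (hu : u ∉ A) (hz : z ∈ A) :
    G.dist u z = G.dist u r + 1 + G.dist s z := by
  have d1 : G.dist r s = 1 := SimpleGraph.dist_eq_one_iff_adj.2 hrs
  apply le_antisymm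
  · have h1 := hG.dist_triangle (u := u) (v := r) (w := z)
    have h2 := hG.dist_triangle (u := r) (v := s) (w := z)
    omega
  · have key : ∀ u z (w : G.Walk u z), u ∉ A → z ∈ A →
        G.dist u r + 1 + G.dist s z ≤ w.length := by
      intro u z w
      induction w with
      | nil => exact fun h1 h2 => absurd h2 h1
      | @cons a b c hab p ih =>
        intro ha hc
        rw [SimpleGraph.Walk.length_cons]
        by_cases hb : b ∈ A
        · obtain ⟨rfl, rfl⟩ := hA a b ha hb hab
          have := SimpleGraph.dist_le p
          simp only [SimpleGraph.dist_self]
          omega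
        · have := ih hb hc
          have h1 := hG.dist_triangle (u := a) (v := b) (w := r)
          have h2 : G.dist a b = 1 := SimpleGraph.dist_eq_one_iff_adj.2 hab
          omega
    obtain ⟨w, hw⟩ := hG.exists_walk_length_eq_dist u z
    rw [← hw]
    exact key u z w hu hz

lemma step_toward {V : Type*} {G : SimpleGraph V} (hG : G.Connected) {x y : V} (hxy : x ≠ y) :
    ∃ x', G.Adj x x' ∧ G.dist x' y < G.dist x y := by
  obtain ⟨w, hw⟩ := hG.exists_walk_length_eq_dist x y
  cases w with
  | nil => exact absurd rfl hxy
  | @cons _ b _ hab p =>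
    refine ⟨b, hab, ?_⟩
    have := SimpleGraph.dist_le p
    rw [SimpleGraph.Walk.length_cons] at hw
    omega

lemma min_adj {V : Type*} [Fintype V] {G : SimpleGraph V} (hG : G.IsTree) (x y : V)
    (hx : ∀ v, ∑ u, G.dist u x ≤ ∑ u, G.dist u v) (hy : ∀ v, ∑ u, G.dist u y ≤ ∑ u, G.dist u v)
    (hne : x ≠ y) : G.Adj x y := by
  by_contra hnadj
  have hc := hG.connected
  obtain ⟨x', hxx, hx1⟩ := step_toward hc hne
  obtain ⟨y', hyy, hy1⟩ := step_toward hc hne.symm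
  obtain ⟨A, a1, a2, a3, -, -⟩ := tree_side hG hxx
  obtain ⟨C, c1, c2, c3, -, -⟩ := tree_side hG hyy
  have dA := fun u z (hu : u ∉ A) (hz : z ∈ A) => side_dist hc hxx A a3 hu hz
  have dC := fun u z (hu : u ∉ C) (hz : z ∈ C) => side_dist hc hyy C c3 hu hz
  have Ain : ∀ u, u ∈ A → G.dist u x = G.dist u x' + 1 := fun u hu => by
    have := dA x u a2 hu
    rw [SimpleGraph.dist_comm, this, SimpleGraph.dist_self, SimpleGraph.dist_comm (u := x') (v := u)]; omega
  have Aout : ∀ u, u ∉ A → G.dist u x' = G.dist u x + 1 := fun u hu => by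
    have := dA u x' hu a1
    rw [this, SimpleGraph.dist_self]
  have Cin : ∀ u, u ∈ C → G.dist u y = G.dist u y' + 1 := fun u hu => by
    have := dC y u c2 hu
    rw [SimpleGraph.dist_comm, this, SimpleGraph.dist_self, SimpleGraph.dist_comm (u := y') (v := u)]; omega
  have Cout : ∀ u, u ∉ C → G.dist u y' = G.dist u y + 1 := fun u hu => by
    have := dC u y' hu c1
    rw [this, SimpleGraph.dist_self]
  have yA : y ∈ A := by
    by_contra h
    have := Aout y h
    rw [SimpleGraph.dist_comm (u := y) (v := x'), SimpleGraph.dist_comm (u := y) (v := x)] at this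
    omega
  have xC : x ∈ C := by
    by_contra h
    have := Cout x h
    rw [SimpleGraph.dist_comm (u := x) (v := y'), SimpleGraph.dist_comm (u := x) (v := y)] at this
    omega
  have x'C : x' ∈ C := by
    by_contra h
    have h1 := dC x' x h xC
    have h2 : G.dist x' x = 1 := SimpleGraph.dist_eq_one_iff_adj.2 hxx.symm
    have h3 : G.dist x' y = 0 := by omega
    rw [hc.dist_eq_zero_iff] at h3
    exact hnadj (h3 ▸ hxx)
  have lt : ∑ u, (G.dist u x' + G.dist u y') < ∑ u, (G.dist u x + G.dist u y) := by
    refine Finset.sum_lt_sum ?_ ⟨x', Finset.mem_univ _, ?_⟩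
    · intro u _
      by_cases huA : u ∈ A
      · have h1 := Ain u huA
        by_cases huC : u ∈ C
        · have := Cin u huC; omega
        · have := Cout u huC; omega
      · have h1 := Aout u huA
        by_cases huC : u ∈ C
        · have := Cin u huC; omega
        · have h2 := dA u y huA yA
          have h3 := dC u x huC xC
          omega
    · have := Ain x' a1
      have := Cin x' x'C
      omega
  rw [Finset.sum_add_distrib, Finset.sum_add_distrib] at lt
  have := hx x'
  have := hy y'
  omega

lemma iso_dist_le {V : Type*} {G : SimpleGraph V} (hG : G.Connected) (σ : G ≃g G) (x y : V) :
    G.dist (σ x) (σ y) ≤ G.dist x y := by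
  obtain ⟨w, hw⟩ := hG.exists_walk_length_eq_dist x y
  rw [← hw, ← SimpleGraph.Walk.length_map σ.toHom w]
  exact SimpleGraph.dist_le _

lemma iso_sum {V : Type*} [Fintype V] {G : SimpleGraph V} (hG : G.Connected) (σ : G ≃g G)
    (x : V) : ∑ u, G.dist u (σ x) ≤ ∑ u, G.dist u x := by
  rw [← Equiv.sum_comp σ.toEquiv (fun u => G.dist u (σ x))]
  exact Finset.sum_le_sum fun u _ => iso_dist_le hG σ u x

lemma no_triangle {V : Type*} {G : SimpleGraph V} (hG : G.IsTree) {r s z : V}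
    (h1 : G.Adj r s) (h2 : G.Adj r z) (h3 : G.Adj s z) : False := by
  obtain ⟨A, a1, a2, a3, -, -⟩ := tree_side hG h1
  by_cases hz : z ∈ A
  · exact h3.ne (a3 r z a2 hz h2).2.symm
  · exact h2.ne (a3 z s hz a1 h3.symm).1.symm

lemma main_aux {V : Type*} [Fintype V] (G : SimpleGraph V) (hG : G.IsTree) (k : ℕ)
    (f : V → ℕ) (hfk : ∀ v, f v ∈ Finset.range k) (hf : DistinguishesU G f)
    (L : V → Finset ℕ) (hL : ∀ v, (L v).card = k) :
    ∃ φ : V → ℕ, (∀ v, φ v ∈ L v) ∧ DistinguishesU G φ := by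
  classical
  have hc := hG.connected
  have : Nonempty V := hc.nonempty
  obtain ⟨r, hr⟩ := Finite.exists_min (fun v : V => ∑ u, G.dist u v)
  have hm : ∀ σ : G ≃g G, ∀ t, (∀ v, ∑ u, G.dist u t ≤ ∑ u, G.dist u v) →
      ∀ v, ∑ u, G.dist u (σ t) ≤ ∑ u, G.dist u v :=
    fun σ t ht v => (iso_sum hc σ t).trans (ht v)
  by_cases hfix : ∀ σ : G ≃g G, σ r = r
  · have g := good_tree _ G hG rfl r k L hL
    have : 0 < (dcols G r (fun _ => Finset.range k)).card :=
      Finset.card_pos.2 ⟨f, (mem_dcols _ _ _ _).2 ⟨hfk, fun σ _ h => hf σ h⟩⟩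
    obtain ⟨φ, hφ⟩ := Finset.card_pos.1 (this.trans_le g)
    rw [mem_dcols] at hφ
    exact ⟨φ, hφ.1, fun σ h => hφ.2 σ (hfix σ) h⟩
  · push Not at hfix
    obtain ⟨σ₀, h₀⟩ := hfix
    obtain ⟨s, hs⟩ : ∃ s, s = σ₀ r := ⟨_, rfl⟩
    have hsm : ∀ v, ∑ u, G.dist u s ≤ ∑ u, G.dist u v := hs ▸ hm σ₀ r hr
    have hne : r ≠ s := by rw [hs]; exact h₀.symm
    have hrs : G.Adj r s := min_adj hG r s hr hsm hne
    have two : ∀ z, (∀ v, ∑ u, G.dist u z ≤ ∑ u, G.dist u v) → z = r ∨ z = s := by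
      intro z hz
      by_contra hcon
      push Not at hcon
      exact no_triangle hG hrs (min_adj hG r z hr hz hcon.1.symm)
        (min_adj hG s z hsm hz hcon.2.symm)
    have inv : ∀ σ : G ≃g G, (σ s = s ∧ σ r = r) ∨ (σ s = r ∧ σ r = s) := by
      intro σ
      have hn : σ r ≠ σ s := fun h => hne (σ.injective h)
      rcases two _ (hm σ r hr) with h1 | h1 <;> rcases two _ (hm σ s hsm) with h2 | h2
      · exact absurd (h1.trans h2.symm) hn
      · exact Or.inl ⟨h2, h1⟩
      · exact Or.inr ⟨h2, h1⟩
      · exact absurd (h1.trans h2.symm) hn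
    obtain ⟨A, hsA, hrA, hA, c1, c2⟩ := tree_side hG hrs
    have g1 := good_tree _ (G.induce A) ⟨c1, hG.isAcyclic.induce A⟩ rfl ⟨s, hsA⟩
    have g2 := good_tree _ (G.induce Aᶜ) ⟨c2, hG.isAcyclic.induce _⟩ rfl ⟨r, hrA⟩
    let e := glueIso G A r s hsA hrA hrs hA
    have es : e (Sum.inl ⟨s, hsA⟩) = s := rfl
    have er : e (Sum.inr ⟨r, hrA⟩) = r := rfl
    obtain ⟨φ, hφ1, hφ2⟩ := glue_edge c1 c2 g1 g2 (by
      intro σ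
      have := inv ((e.symm.trans σ).trans e)
      have es' : e.symm s = Sum.inl ⟨s, hsA⟩ := by rw [RelIso.symm_apply_eq]; exact es.symm
      have er' : e.symm r = Sum.inr ⟨r, hrA⟩ := by rw [RelIso.symm_apply_eq]; exact er.symm
      simp only [RelIso.trans_apply, es', er'] at this
      refine this.imp ?_ ?_
      · rintro ⟨u1, u2⟩
        exact ⟨e.injective (u1.trans es.symm), e.injective (u2.trans er.symm)⟩
      · rintro ⟨u1, u2⟩
        exact ⟨e.injective (u1.trans er.symm), e.injective (u2.trans es.symm)⟩)
      k (fun x => L (e x)) (fun v => hL _) (fun x => f (e x)) (fun v => hfk _) (distU_iso e f hf)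
    refine ⟨fun v => φ (e.symm v), fun v => ?_, distU_iso e.symm φ hφ2⟩
    have := hφ1 (e.symm v)
    simpa using this

theorem stmt8 {V : Type*} [Fintype V] (G : SimpleGraph V) (hG : G.IsTree) :
    DListNumU G = DNumU G := by
  classical
  have hne : {k | ∃ φ : V → Fin k, DistinguishesU G φ}.Nonempty := by
    refine ⟨Fintype.card V, Fintype.equivFin V, ?_⟩
    intro σ h w
    exact (Fintype.equivFin V).injective (h w)
  have hmem : DNumU G ∈ {k | ∀ L : V → Finset ℕ, (∀ v, (L v).card = k) →
      ∃ φ : V → ℕ, (∀ v, φ v ∈ L v) ∧ DistinguishesU G φ} := by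
    obtain ⟨φ, hφ⟩ := Nat.sInf_mem hne
    intro L hL
    refine main_aux G hG _ (fun v => (φ v : ℕ)) (fun v => Finset.mem_range.2 (φ v).2) ?_ L hL
    intro σ h w
    exact hφ σ (fun w => Fin.ext (h w)) w
  apply le_antisymm
  · exact Nat.sInf_le hmem
  · refine Nat.sInf_le ?_
    obtain ⟨φ, h1, h2⟩ := Nat.sInf_mem ⟨_, hmem⟩ (fun _ => Finset.range _)
      (fun _ => Finset.card_range _)
    refine ⟨fun v => ⟨φ v, Finset.mem_range.1 (h1 v)⟩, ?_⟩
    intro σ h w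
    exact h2 σ (fun w => congrArg Fin.val (h w)) w
end
end

section
/- Let T_v be a rooted tree with root v whose children are partitioned into classes C_1,…,C_t by rooted-tree isomorphism of their subtrees, with representative v_j in class C_j. Then for every color i ∈ {1,…,k}, the number of equivalence classes of distinguishing proper k-colorings of T_v with root colored i equals ∏_{j=1}^{t} binom((k−1)·D_χ(T_{v_j}; k, 1), |C_j|). -/
open SimpleGraph

noncomputable section

structure BranchDec {V ι : Type*} (G : SimpleGraph V) (x : V) (ch : ι → V) : Prop where
  ex : ∀ w, w ≠ x → ∃ s, w ∈ desc G x (ch s)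
  uniq : ∀ s s' w, w ∈ desc G x (ch s) → w ∈ desc G x (ch s') → s = s'
  nx : ∀ s, x ∉ desc G x (ch s)
  adj : ∀ s w, w ∈ desc G x (ch s) → (G.Adj x w ↔ w = ch s)
  cross : ∀ s s' a b, a ∈ desc G x (ch s) → b ∈ desc G x (ch s') → G.Adj a b → s = s'

lemma tree_child_unique {V : Type*} {G : SimpleGraph V} (hG : G.IsTree) {x v v' w : V}
    (h : G.Adj x v) (h' : G.Adj x v') (hw : w ∈ desc G x v) (hw' : w ∈ desc G x v') : v = v' := by
  have d1 : G.dist v x = 1 := by rw [SimpleGraph.dist_comm]; exact dist_eq_one_iff_adj.2 h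
  have d2 : G.dist v' x = 1 := by rw [SimpleGraph.dist_comm]; exact dist_eq_one_iff_adj.2 h'
  simp only [desc, Set.mem_ofPred_eq, d1, d2] at hw hw'
  obtain ⟨p, hp⟩ := hG.connected.exists_walk_length_eq_dist v w
  obtain ⟨q, hq⟩ := hG.connected.exists_walk_length_eq_dist v' w
  have hp' : (Walk.cons h p).IsPath := by
    apply Walk.isPath_of_length_eq_dist
    rw [Walk.length_cons, hp, SimpleGraph.dist_comm, ← hw, SimpleGraph.dist_comm]
  have hq' : (Walk.cons h' q).IsPath := by
    apply Walk.isPath_of_length_eq_dist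
    rw [Walk.length_cons, hq, SimpleGraph.dist_comm, ← hw', SimpleGraph.dist_comm]
  have := hG.IsAcyclic.path_unique ⟨_, hp'⟩ ⟨_, hq'⟩
  have := congrArg (fun z : G.Path x w => z.1.snd) this
  simpa using this

lemma tree_branchDec {V ι : Type*} {G : SimpleGraph V} (hG : G.IsTree) (x : V) (ch : ι → V)
    (hinj : Function.Injective ch) (hch : ∀ w, G.Adj x w ↔ ∃ s, ch s = w) :
    BranchDec G x ch := by
  have hadj : ∀ s, G.Adj x (ch s) := fun s => (hch _).2 ⟨s, rfl⟩
  have d1 : ∀ s, G.dist (ch s) x = 1 := fun s => by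
    rw [SimpleGraph.dist_comm]; exact dist_eq_one_iff_adj.2 (hadj s)
  have uniq : ∀ s s' w, w ∈ desc G x (ch s) → w ∈ desc G x (ch s') → s = s' :=
    fun s s' w h h' => hinj (tree_child_unique hG (hadj s) (hadj s') h h')
  have key : ∀ s s' a b, a ∈ desc G x (ch s) → b ∈ desc G x (ch s') → G.Adj a b →
      G.dist a x < G.dist b x → s = s' := by
    intro s s' a b ha hb hab hlt
    refine uniq s s' b ?_ hb
    simp only [desc, Set.mem_ofPred_eq, d1] at ha ⊢
    have t1 := hG.connected.dist_triangle (u := b) (v := a) (w := ch s)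
    have t2 := hG.connected.dist_triangle (u := b) (v := ch s) (w := x)
    have t3 : G.dist b a = 1 := dist_eq_one_iff_adj.2 hab.symm
    have := d1 s
    omega
  refine ⟨?_, uniq, ?_, ?_, ?_⟩
  · intro w hw
    obtain ⟨p, hp⟩ := hG.connected.exists_walk_length_eq_dist x w
    cases p with
    | nil => exact absurd rfl hw
    | @cons _ v _ h q =>
      obtain ⟨s, rfl⟩ := (hch v).1 h
      refine ⟨s, ?_⟩
      simp only [desc, Set.mem_ofPred_eq, d1]
      have t1 := dist_le q
      have t2 := hG.connected.dist_triangle (u := w) (v := ch s) (w := x)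
      rw [Walk.length_cons] at hp
      rw [d1] at t2
      rw [SimpleGraph.dist_comm] at hp t1
      have t3 := SimpleGraph.dist_comm (G := G) (u := w) (v := ch s)
      have t4 := SimpleGraph.dist_comm (G := G) (u := w) (v := x)
      omega
  · intro s h
    simp [desc, d1] at h
  · intro s w hw
    constructor
    · intro h
      exact tree_child_unique hG h (hadj s) (self_mem_desc G x w) hw
    · rintro rfl; exact hadj s
  · intro s s' a b ha hb hab
    rcases lt_trichotomy (G.dist a x) (G.dist b x) with h | h | h
    · exact key _ _ _ _ ha hb hab h
    · exact absurd (by rw [SimpleGraph.dist_comm, h, SimpleGraph.dist_comm]) (hG.dist_ne_of_adj x hab)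
    · exact (key _ _ _ _ hb ha hab.symm h).symm

def glueFun {V ι : Type*} (G : SimpleGraph V) (x : V) (ch : ι → V) :
    Option (Σ s, desc G x (ch s)) → V
  | none => x
  | some p => p.2.1

lemma glueFun_bij {V ι : Type*} {G : SimpleGraph V} {x : V} {ch : ι → V}
    (B : BranchDec G x ch) : Function.Bijective (glueFun G x ch) := by
  constructor
  · rintro (_ | ⟨s, a, ha⟩) (_ | ⟨s', b, hb⟩) h
    · rfl
    · exact absurd hb (by have : x = b := h
                          exact this ▸ B.nx s')
    · exact absurd ha (by have : a = x := h
                          exact this ▸ B.nx s)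
    · have : a = b := h
      subst this
      obtain rfl := B.uniq _ _ _ ha hb
      rfl
  · intro w
    by_cases h : w = x
    · exact ⟨none, h.symm⟩
    · obtain ⟨s, hs⟩ := B.ex w h
      exact ⟨some ⟨s, w, hs⟩, rfl⟩

abbrev Br {V : Type*} (G : SimpleGraph V) (x v : V) : SimpleGraph (desc G x v) :=
  G.induce (desc G x v)

abbrev rt {V : Type*} (G : SimpleGraph V) (x v : V) : desc G x v := ⟨v, self_mem_desc G x v⟩

lemma glue_iso {V ι : Type*} {G : SimpleGraph V} {x : V} {ch : ι → V}
    (B : BranchDec G x ch) (τ : Equiv.Perm ι) (π : ∀ s, Br G x (ch s) ≃g Br G x (ch (τ s)))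
    (hπ : ∀ s, π s (rt G x (ch s)) = rt G x (ch (τ s))) :
    ∃ σ : G ≃g G, σ x = x ∧ ∀ s (a : desc G x (ch s)), σ a = π s a := by
  let e := Equiv.ofBijective _ (glueFun_bij B)
  let m : Option (Σ s, desc G x (ch s)) ≃ Option (Σ s, desc G x (ch s)) :=
    Equiv.optionCongr (Equiv.sigmaCongr τ (fun s => (π s).toEquiv))
  let σ : V ≃ V := e.symm.trans (m.trans e)
  have h0 : σ x = x := by
    have : e.symm x = none := by rw [Equiv.symm_apply_eq]; rfl
    change e (m (e.symm x)) = x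
    rw [this]; rfl
  have h1 : ∀ s (a : desc G x (ch s)), σ a = π s a := by
    intro s a
    have : e.symm a = some ⟨s, a⟩ := by rw [Equiv.symm_apply_eq]; rfl
    change e (m (e.symm a)) = _
    rw [this]; rfl
  have hx : ∀ s (a : desc G x (ch s)), G.Adj x (π s a) ↔ G.Adj x a := by
    intro s a
    rw [B.adj _ _ (π s a).2, B.adj _ _ a.2]
    have e1 : (π s a : V) = ch (τ s) ↔ π s a = rt G x (ch (τ s)) := by
      rw [Subtype.ext_iff]
    have e2 : (a : V) = ch s ↔ a = rt G x (ch s) := by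
      rw [Subtype.ext_iff]
    rw [e1, e2, ← hπ]
    exact (π s).injective.eq_iff
  refine ⟨⟨σ, ?_⟩, h0, h1⟩
  intro a b
  by_cases ha : a = x
  · subst ha
    by_cases hb : b = a
    · subst hb; simp
    · obtain ⟨s, hs⟩ := B.ex b hb
      rw [h0, h1 s ⟨b, hs⟩]
      exact hx s ⟨b, hs⟩
  · obtain ⟨s, hs⟩ := B.ex a ha
    rw [h1 s ⟨a, hs⟩]
    by_cases hb : b = x
    · subst hb
      rw [h0, G.adj_comm, G.adj_comm a]
      exact hx s ⟨a, hs⟩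
    · obtain ⟨s', hs'⟩ := B.ex b hb
      rw [h1 s' ⟨b, hs'⟩]
      constructor
      · intro h
        have := τ.injective (B.cross _ _ _ _ (π s ⟨a, hs⟩).2 (π s' ⟨b, hs'⟩).2 h)
        subst this
        exact (π s).map_adj_iff.1 h
      · intro h
        have := B.cross _ _ _ _ hs hs' h
        subst this
        exact (π s).map_adj_iff (v := ⟨a, hs⟩) (w := ⟨b, hs'⟩) |>.2 h

lemma iso_edist_le {V W : Type*} {G : SimpleGraph V} {H : SimpleGraph W} (σ : G ≃g H) (a b : V) :
    H.edist (σ a) (σ b) ≤ G.edist a b := by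
  unfold SimpleGraph.edist
  refine le_iInf fun w => iInf_le_of_le (w.map σ.toHom) ?_
  simp

lemma iso_dist {V W : Type*} {G : SimpleGraph V} {H : SimpleGraph W} (σ : G ≃g H) (a b : V) :
    H.dist (σ a) (σ b) = G.dist a b := by
  have h1 := iso_edist_le σ a b
  have h2 := iso_edist_le σ.symm (σ a) (σ b)
  simp only [RelIso.symm_apply_apply] at h2
  unfold SimpleGraph.dist
  rw [le_antisymm h1 h2]

lemma restrict_iso {V : Type*} {G : SimpleGraph V} {x v w : V} (σ : G ≃g G) (hx : σ x = x)
    (hv : σ v = w) : ∃ π : Br G x v ≃g Br G x w, ∀ a, (π a : V) = σ a := by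
  have hm : ∀ a, a ∈ desc G x v ↔ σ a ∈ desc G x w := by
    intro a
    simp only [desc, Set.mem_ofPred_eq]
    have h1 := iso_dist σ a x
    have h2 := iso_dist σ a v
    have h3 := iso_dist σ v x
    rw [hx] at h1 h3
    rw [hv] at h2 h3
    rw [h1, h2, h3]
  refine ⟨⟨σ.toEquiv.subtypeEquiv hm, ?_⟩, fun a => rfl⟩
  intro a b
  exact σ.map_adj_iff

lemma colEquiv_refl {V α : Type*} (G : SimpleGraph V) (r : V) (φ : V → α) :
    ColEquiv G G r r φ φ := ⟨Iso.refl, rfl, fun _ => rfl⟩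

lemma ColEquiv.symm {V W α : Type*} {G : SimpleGraph V} {H : SimpleGraph W} {r : V} {s : W}
    {φ : V → α} {ψ : W → α} (h : ColEquiv G H r s φ ψ) : ColEquiv H G s r ψ φ := by
  obtain ⟨π, h1, h2⟩ := h
  refine ⟨π.symm, ?_, ?_⟩
  · rw [← h1]; simp
  · intro w; rw [h2]; simp

lemma ColEquiv.trans {V W U α : Type*} {G : SimpleGraph V} {H : SimpleGraph W} {K : SimpleGraph U}
    {r : V} {s : W} {q : U}
    {φ : V → α} {ψ : W → α} {χ : U → α} (h : ColEquiv G H r s φ ψ) (h' : ColEquiv H K s q ψ χ) :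
    ColEquiv G K r q φ χ := by
  obtain ⟨π, h1, h2⟩ := h
  obtain ⟨π', h1', h2'⟩ := h'
  refine ⟨π.trans π', ?_, ?_⟩
  · simp [h1, h1']
  · intro w; rw [h2, h2']; rfl

lemma ColEquiv.proper {V W α : Type*} {G : SimpleGraph V} {H : SimpleGraph W} {r : V} {s : W}
    {φ : V → α} {ψ : W → α} (h : ColEquiv G H r s φ ψ) (hp : IsProper H ψ) : IsProper G φ := by
  obtain ⟨π, h1, h2⟩ := h
  intro a b hab
  rw [h2, h2]
  exact hp _ _ (π.map_adj_iff.2 hab)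

lemma ColEquiv.root {V W α : Type*} {G : SimpleGraph V} {H : SimpleGraph W} {r : V} {s : W}
    {φ : V → α} {ψ : W → α} (h : ColEquiv G H r s φ ψ) : φ r = ψ s := by
  obtain ⟨π, h1, h2⟩ := h
  rw [h2, h1]

lemma ColEquiv.dist {V W α : Type*} {G : SimpleGraph V} {H : SimpleGraph W} {r : V} {s : W}
    {φ : V → α} {ψ : W → α} (h : ColEquiv G H r s φ ψ) (hp : Distinguishes H s ψ) :
    Distinguishes G r φ := by
  obtain ⟨π, h1, h2⟩ := h
  intro σ hσ hc w
  have := hp (π.symm.trans (σ.trans π)) (by rw [← h1]; simp [hσ]) (by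
    intro w
    have := hc (π.symm w)
    rw [h2, h2] at this
    simpa using this) (π w)
  simpa using this

abbrev res {V α : Type*} (G : SimpleGraph V) (x v : V) (f : V → α) : desc G x v → α := fun w => f w

lemma equiv_of_perm {V ι α : Type*} {G : SimpleGraph V} {x : V} {ch : ι → V}
    (B : BranchDec G x ch) (f g : V → α) (hfg : f x = g x) (τ : Equiv.Perm ι)
    (h : ∀ s, ColEquiv (Br G x (ch s)) (Br G x (ch (τ s))) (rt G x _) (rt G x _)
      (res G x _ f) (res G x _ g)) :
    ∃ σ : G ≃g G, σ x = x ∧ (∀ w, f w = g (σ w)) ∧ ∀ s, σ (ch s) = ch (τ s) := by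
  choose π h1 h2 using h
  obtain ⟨σ, hx, hs⟩ := glue_iso B τ π h1
  refine ⟨σ, hx, ?_, ?_⟩
  · intro w
    by_cases hw : w = x
    · rw [hw, hx, hfg]
    · obtain ⟨s, hw⟩ := B.ex w hw
      rw [hs s ⟨w, hw⟩]
      exact h2 s ⟨w, hw⟩
  · intro s
    have := hs s (rt G x _)
    rw [h1] at this
    exact this

lemma colEquiv_of_iso {V α : Type*} {G : SimpleGraph V} {x v w : V} (f g : V → α)
    (σ : G ≃g G) (hx : σ x = x) (hv : σ v = w) (hc : ∀ w, f w = g (σ w)) :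
    ColEquiv (Br G x v) (Br G x w) (rt G x _) (rt G x _) (res G x _ f) (res G x _ g) := by
  obtain ⟨π, hπ⟩ := restrict_iso σ hx hv
  refine ⟨π, Subtype.ext ?_, ?_⟩
  · rw [hπ]; exact hv
  · intro a; simp only [res]; rw [hπ]; exact hc _

lemma dist_iff {V ι α : Type*} {G : SimpleGraph V} {x : V} {ch : ι → V}
    (B : BranchDec G x ch) (hinj : Function.Injective ch) (f : V → α) (hch : ∀ w, G.Adj x w ↔ ∃ s, ch s = w) :
    Distinguishes G x f ↔ (∀ s, Distinguishes (Br G x (ch s)) (rt G x _) (res G x _ f)) ∧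
      ∀ s s', ColEquiv (Br G x (ch s)) (Br G x (ch s')) (rt G x _) (rt G x _)
        (res G x _ f) (res G x _ f) → s = s' := by
  classical
  constructor
  · intro hd
    constructor
    · intro s σ' hσ hc
      let π : ∀ s, Br G x (ch s) ≃g Br G x (ch s) := Function.update (fun s => Iso.refl) s σ'
      have hπs : π s = σ' := Function.update_self ..
      have hπn : ∀ s', s' ≠ s → π s' = Iso.refl := fun s' h => Function.update_of_ne h ..
      obtain ⟨σ, hx, hs⟩ := glue_iso B (Equiv.refl ι) π (by
        intro s'
        by_cases h : s' = s
        · subst h; rw [hπs]; exact hσ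
        · rw [hπn _ h]; rfl)
      have := hd σ hx (by
        intro w
        by_cases hw : w = x
        · rw [hw, hx]
        · obtain ⟨s', hw⟩ := B.ex w hw
          rw [hs s' ⟨w, hw⟩]
          by_cases h : s' = s
          · subst h; rw [hπs]; exact hc _
          · rw [hπn _ h]; rfl)
      intro w
      apply Subtype.ext
      have h2 := hs s w
      rw [this, hπs] at h2
      exact h2.symm
    · intro s s' h
      obtain ⟨σ, hx, hc, hs⟩ := equiv_of_perm B f f rfl (Equiv.swap s s') (by
        intro a
        by_cases h1 : a = s
        · subst h1; rw [Equiv.swap_apply_left]; exact h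
        · by_cases h2 : a = s'
          · subst h2; rw [Equiv.swap_apply_right]; exact h.symm
          · rw [Equiv.swap_apply_of_ne_of_ne h1 h2]; exact colEquiv_refl _ _ _)
      have h3 := hs s
      rw [hd σ hx (fun w => (hc w).symm), Equiv.swap_apply_left] at h3
      exact hinj h3
  · rintro ⟨h1, h2⟩ σ hx hc w
    by_cases hw : w = x
    · rw [hw, hx]
    · obtain ⟨s, hw⟩ := B.ex w hw
      have hadj : G.Adj x (σ (ch s)) := by
        have := σ.map_adj_iff.2 ((hch _).2 ⟨s, rfl⟩)
        rwa [hx] at this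
      obtain ⟨s', hs'⟩ := (hch _).1 hadj
      obtain rfl := h2 s s' (colEquiv_of_iso f f σ hx hs'.symm (fun w => (hc w).symm))
      obtain ⟨π, hπ⟩ := restrict_iso σ hx hs'.symm
      have := h1 s π (Subtype.ext (by rw [hπ]; exact hs'.symm)) (by
        intro a; simp only [res]; rw [hπ]; exact hc _) ⟨w, hw⟩
      have := congrArg Subtype.val this
      rwa [hπ] at this

lemma proper_iff {V ι α : Type*} {G : SimpleGraph V} {x : V} {ch : ι → V}
    (B : BranchDec G x ch) (f : V → α) :
    IsProper G f ↔ ∀ s, IsProper (Br G x (ch s)) (res G x _ f) ∧ f (ch s) ≠ f x := by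
  constructor
  · intro h s
    refine ⟨fun a b hab => h _ _ hab, fun h' => h x (ch s) ?_ h'.symm⟩
    exact (B.adj s _ (self_mem_desc G x _)).2 rfl
  · intro h a b hab
    by_cases ha : a = x
    · subst ha
      obtain ⟨s, hs⟩ := B.ex b hab.ne.symm
      rw [(B.adj s b hs).1 hab]
      exact (h s).2.symm
    · obtain ⟨s, hs⟩ := B.ex a ha
      by_cases hb : b = x
      · subst hb
        rw [(B.adj s a hs).1 hab.symm]
        exact (h s).2
      · obtain ⟨s', hs'⟩ := B.ex b hb
        obtain rfl := B.cross _ _ _ _ hs hs' hab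
        exact (h s).1 ⟨a, hs⟩ ⟨b, hs'⟩ hab

lemma extend_col {V ι α : Type*} {G : SimpleGraph V} {x : V} {ch : ι → V}
    (B : BranchDec G x ch) (i : α) (c : ∀ s, desc G x (ch s) → α) :
    ∃ f : V → α, f x = i ∧ ∀ s, res G x (ch s) f = c s := by
  let e := Equiv.ofBijective _ (glueFun_bij B)
  let g : Option (Σ s, desc G x (ch s)) → α := fun o => o.elim i (fun p => c p.1 p.2)
  refine ⟨fun w => g (e.symm w), ?_, ?_⟩
  · have : e.symm x = none := by rw [Equiv.symm_apply_eq]; rfl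
    simp only [this]; rfl
  · intro s
    funext a
    have : e.symm a = some ⟨s, a⟩ := by rw [Equiv.symm_apply_eq]; rfl
    simp only [res, this]; rfl

lemma count_lemma {A : Type*} (r : A → A → Prop) (t : ℕ) (c X : Fin t → Type*)
    [∀ j, Fintype (c j)] [∀ j, Finite (X j)] (F : A → ∀ j, c j → X j)
    (h1 : ∀ a j, Function.Injective (F a j))
    (h2 : ∀ h : ∀ j, c j → X j, (∀ j, Function.Injective (h j)) → ∃ a, F a = h)
    (h3 : ∀ a b, r a b → ∀ j, Set.range (F a j) = Set.range (F b j))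
    (h4 : ∀ a b, (∀ j, Set.range (F a j) = Set.range (F b j)) → r a b) :
    Nat.card (Quot r) = ∏ j, Nat.choose (Nat.card (X j)) (Fintype.card (c j)) := by
  classical
  have : ∀ j, Fintype (X j) := fun j => Fintype.ofFinite _
  let P : Fin t → Type _ := fun j => {S : Finset (X j) // S.card = Fintype.card (c j)}
  have hP : ∀ j, Nat.card (P j) = Nat.choose (Nat.card (X j)) (Fintype.card (c j)) := by
    intro j
    rw [Nat.card_eq_fintype_card, Nat.card_eq_fintype_card, Fintype.card_finset_len]
  let Φ : A → ∀ j, P j := fun a j => ⟨Finset.univ.image (F a j), by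
    rw [Finset.card_image_of_injective _ (h1 a j), Finset.card_univ]⟩
  have hΦ : ∀ a b, Φ a = Φ b ↔ ∀ j, Set.range (F a j) = Set.range (F b j) := by
    intro a b
    rw [funext_iff]
    refine forall_congr' fun j => ?_
    rw [Subtype.ext_iff, ← Finset.coe_inj]
    simp [Φ]
  have hlift : ∀ a b, r a b → Φ a = Φ b := fun a b h => (hΦ a b).2 (h3 a b h)
  simp_rw [← hP]
  rw [← Nat.card_pi]
  refine Nat.card_eq_of_bijective (Quot.lift Φ hlift) ⟨?_, ?_⟩
  · rintro ⟨a⟩ ⟨b⟩ h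
    exact Quot.sound (h4 a b ((hΦ a b).1 h))
  · intro S
    have hh : ∀ j, ∃ h : c j → X j, Function.Injective h ∧ Finset.univ.image h = (S j).1 := by
      intro j
      have e : c j ≃ (S j).1 := Fintype.equivOfCardEq (by
        rw [Fintype.card_coe, (S j).2])
      refine ⟨fun v => (e v).1, fun v w h => e.injective (Subtype.ext h), ?_⟩
      ext y
      simp only [Finset.mem_image, Finset.mem_univ, true_and]
      constructor
      · rintro ⟨v, rfl⟩; exact (e v).2
      · intro hy; exact ⟨e.symm ⟨y, hy⟩, by simp⟩
    choose h hi hs using hh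
    obtain ⟨a, ha⟩ := h2 h hi
    refine ⟨Quot.mk _ a, ?_⟩
    funext j
    apply Subtype.ext
    change Finset.univ.image (F a j) = _
    rw [ha, hs]

def colRel {W : Type*} {k : ℕ} (H : SimpleGraph W) (r : W) (p : (W → Fin k) → Prop) :
    {f : W → Fin k // p f} → {f : W → Fin k // p f} → Prop :=
  fun φ ψ => ∃ σ : H ≃g H, σ r = r ∧ ∀ w, φ.1 w = ψ.1 (σ w)

lemma colRel_eq {W : Type*} {k : ℕ} {H : SimpleGraph W} {r : W} {p : (W → Fin k) → Prop}
    (φ ψ : {f : W → Fin k // p f}) : Quot.mk (colRel H r p) φ = Quot.mk (colRel H r p) ψ ↔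
      ColEquiv H H r r φ.1 ψ.1 := by
  have heq : Equivalence (colRel H r p) :=
    ⟨fun φ => colEquiv_refl H r φ.1, fun h => ColEquiv.symm h, fun h h' => ColEquiv.trans h h'⟩
  rw [Quot.eq, heq.eqvGen_iff]
  rfl

abbrev XQ {W : Type*} (H : SimpleGraph W) (r : W) (k : ℕ) (i : Fin k) : Type _ :=
  Quot (colRel (k := k) H r (fun f => IsProper H f ∧ Distinguishes H r f ∧ f r ≠ i))

abbrev XI {W : Type*} (H : SimpleGraph W) (r : W) (k : ℕ) (i : Fin k) : Type _ :=
  Quot (colRel (k := k) H r (fun f => IsProper H f ∧ Distinguishes H r f ∧ f r = i))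

lemma XI_card_le {W : Type*} [Finite W] (H : SimpleGraph W) (r : W) (k : ℕ) (i i' : Fin k) :
    Nat.card (XI H r k i) ≤ Nat.card (XI H r k i') := by
  let g : Equiv.Perm (Fin k) := Equiv.swap i i'
  let m : XI H r k i → XI H r k i' := Quot.map (fun f => ⟨fun w => g (f.1 w), by
      obtain ⟨f, h1, h2, h3⟩ := f
      refine ⟨fun a b hab h => h1 a b hab (g.injective h),
        fun σ hσ hc => h2 σ hσ (fun w => g.injective (hc w)), ?_⟩
      simp [h3, g]⟩) (by
    rintro φ ψ ⟨σ, h1, h2⟩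
    exact ⟨σ, h1, fun w => congrArg g (h2 w)⟩)
  refine Nat.card_le_card_of_injective m ?_
  rintro ⟨φ⟩ ⟨ψ⟩ h
  obtain ⟨σ, h1, h2⟩ := (colRel_eq _ _).1 h
  exact (colRel_eq _ _).2 ⟨σ, h1, fun w => g.injective (h2 w)⟩

lemma XQ_card {W : Type*} [Finite W] (H : SimpleGraph W) (r : W) (k : ℕ) (i i' : Fin k) :
    Nat.card (XQ H r k i) = (k - 1) * Nat.card (XI H r k i') := by
  have h : Nat.card (Σ c : {c : Fin k // c ≠ i}, XI H r k c.1) = (k - 1) * Nat.card (XI H r k i') := by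
    rw [Nat.card_sigma, Finset.sum_congr rfl (fun c _ =>
      le_antisymm (XI_card_le H r k c.1 i') (XI_card_le H r k i' c.1))]
    simp
  rw [← h]
  symm
  let m : (Σ c : {c : Fin k // c ≠ i}, XI H r k c.1) → XQ H r k i := fun p =>
    Quot.map (fun f : {f : W → Fin k // IsProper H f ∧ Distinguishes H r f ∧ f r = p.1.1} =>
      ⟨f.1, f.2.1, f.2.2.1, by rw [f.2.2.2]; exact p.1.2⟩)
      (fun _ _ h => h) p.2
  refine Nat.card_eq_of_bijective m ⟨?_, ?_⟩
  · rintro ⟨⟨c, hc⟩, ⟨φ, hφ⟩⟩ ⟨⟨c', hc'⟩, ⟨ψ, hψ⟩⟩ h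
    have h := (colRel_eq _ _).1 h
    have hr := h.root
    have : c = c' := hφ.2.2.symm.trans (Eq.trans hr hψ.2.2)
    subst this
    congr 1
    exact (colRel_eq _ _).2 h
  · rintro ⟨φ, h1, h2, h3⟩
    exact ⟨⟨⟨φ r, h3⟩, Quot.mk _ ⟨φ, h1, h2, rfl⟩⟩, rfl⟩

theorem stmt11 {V : Type*} [Fintype V] (G : SimpleGraph V) (hG : G.IsTree)
    (x : V) (k t : ℕ) (hk : 0 < k) (C : Fin t → Finset V) (u : Fin t → V)
    (hC1 : ∀ j, ∀ v ∈ C j, G.Adj x v)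
    (hC2 : ∀ v : V, G.Adj x v → ∃! j, v ∈ C j)
    (hC3 : ∀ j, ∀ v ∈ C j, ∀ w ∈ C j,
      RootedIso (G.induce (desc G x v)) (G.induce (desc G x w))
        ⟨v, self_mem_desc G x v⟩ ⟨w, self_mem_desc G x w⟩)
    (hC4 : ∀ j j', j ≠ j' → ∀ v ∈ C j, ∀ w ∈ C j',
      ¬ RootedIso (G.induce (desc G x v)) (G.induce (desc G x w))
          ⟨v, self_mem_desc G x v⟩ ⟨w, self_mem_desc G x w⟩)
    (hu : ∀ j, u j ∈ C j) :
    ∀ i : Fin k,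
      DChiCountI G x k i =
        ∏ j : Fin t,
          Nat.choose
            ((k - 1) *
              DChiCountI (G.induce (desc G x (u j)))
                ⟨u j, self_mem_desc G x (u j)⟩ k ⟨0, hk⟩)
            (C j).card := by
  intro i
  classical
  let ι := Σ j, C j
  let ch : ι → V := fun s => s.2.1
  have hinj : Function.Injective ch := by
    rintro ⟨j, v, hv⟩ ⟨j', w, hw⟩ h
    have h : v = w := h
    subst h
    obtain rfl := (hC2 v (hC1 _ _ hv)).unique hv hw
    rfl
  have hch : ∀ w, G.Adj x w ↔ ∃ s, ch s = w := by
    intro w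
    constructor
    · intro h
      obtain ⟨j, hj, _⟩ := hC2 w h
      exact ⟨⟨j, w, hj⟩, rfl⟩
    · rintro ⟨s, rfl⟩; exact hC1 _ _ s.2.2
  have B := tree_branchDec hG x ch hinj hch
  have hρ : ∀ s : ι, ∃ π : Br G x (u s.1) ≃g Br G x (ch s), π (rt G x _) = rt G x _ :=
    fun s => hC3 s.1 _ (hu s.1) _ s.2.2
  choose ρ hρ using hρ
  let bc : (V → Fin k) → ∀ s : ι, desc G x (u s.1) → Fin k := fun f s w => f (ρ s w)
  have hbc : ∀ f s, ColEquiv (Br G x (u s.1)) (Br G x (ch s)) (rt G x _) (rt G x _)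
      (bc f s) (res G x _ f) := fun f s => ⟨ρ s, hρ s, fun _ => rfl⟩
  let A := {f : V → Fin k // IsProper G f ∧ Distinguishes G x f ∧ f x = i}
  let X : Fin t → Type _ := fun j => XQ (Br G x (u j)) (rt G x _) k i
  let F : A → ∀ j, C j → X j := fun f j v => Quot.mk _ ⟨bc f.1 ⟨j, v⟩, by
    have h1 := (proper_iff B f.1).1 f.2.1 ⟨j, v⟩
    have h2 := ((dist_iff B hinj f.1 hch).1 f.2.2.1).1 ⟨j, v⟩
    refine ⟨(hbc f.1 ⟨j, v⟩).proper h1.1, (hbc f.1 ⟨j, v⟩).dist h2, ?_⟩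
    have := h1.2
    rw [f.2.2.2] at this
    rw [(hbc f.1 ⟨j, v⟩).root]
    exact this⟩
  have hF : ∀ (f g : A) j (v w : C j), F f j v = F g j w ↔
      ColEquiv (Br G x (ch ⟨j, v⟩)) (Br G x (ch ⟨j, w⟩)) (rt G x _) (rt G x _)
        (res G x _ f.1) (res G x _ g.1) := by
    intro f g j v w
    rw [colRel_eq]
    constructor
    · intro h
      exact (hbc f.1 ⟨j, v⟩).symm.trans (h.trans (hbc g.1 ⟨j, w⟩))
    · intro h
      exact (hbc f.1 ⟨j, v⟩).trans (h.trans (hbc g.1 ⟨j, w⟩).symm)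
  have hcls : ∀ (s s' : ι) (f g : V → Fin k),
      ColEquiv (Br G x (ch s)) (Br G x (ch s')) (rt G x _) (rt G x _)
        (res G x _ f) (res G x _ g) → s.1 = s'.1 := by
    intro s s' f g h
    by_contra hne
    obtain ⟨π, hπ, _⟩ := h
    exact hC4 _ _ hne _ s.2.2 _ s'.2.2 ⟨π, hπ⟩
  have hsub : ∀ (f g : A), (∃ σ : G ≃g G, σ x = x ∧ ∀ w, f.1 w = g.1 (σ w)) →
      ∀ j, Set.range (F f j) ⊆ Set.range (F g j) := by
    rintro f g ⟨σ, hx, hc⟩ j _ ⟨v, rfl⟩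
    have hadj : G.Adj x (σ v) := by
      have := σ.map_adj_iff.2 (hC1 j v v.2)
      rwa [hx] at this
    obtain ⟨⟨j', w⟩, hw⟩ := (hch _).1 hadj
    have h := colEquiv_of_iso (v := ch ⟨j, v⟩) f.1 g.1 σ hx hw.symm hc
    have hj : j = j' := hcls ⟨j, v⟩ ⟨j', w⟩ _ _ h
    subst hj
    exact ⟨w, ((hF f g j v w).2 h).symm⟩
  have hXfin : ∀ j, Finite (X j) := fun j => inferInstance
  have main := count_lemma
    (fun φ ψ : A => ∃ σ : G ≃g G, σ x = x ∧ ∀ w, φ.1 w = ψ.1 (σ w)) t (fun j => C j) X F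
    (by
      intro f j v w h
      have := ((dist_iff B hinj f.1 hch).1 f.2.2.1).2 ⟨j, v⟩ ⟨j, w⟩ ((hF f f j v w).1 h)
      exact Subtype.ext (congrArg ch this))
    (by
      intro h hh
      have hrep : ∀ s : ι, ∃ c : {f : desc G x (u s.1) → Fin k //
          IsProper (Br G x (u s.1)) f ∧ Distinguishes (Br G x (u s.1)) (rt G x _) f ∧
          f (rt G x _) ≠ i}, Quot.mk _ c = h s.1 s.2 := fun s => Quot.exists_rep _
      choose c hc using hrep
      obtain ⟨f, hfx, hf⟩ := extend_col B i (fun s w => (c s).1 ((ρ s).symm w))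
      have hce : ∀ s, ColEquiv (Br G x (ch s)) (Br G x (u s.1)) (rt G x _) (rt G x _)
          (res G x _ f) (c s).1 := by
        intro s
        rw [hf]
        exact ⟨(ρ s).symm, by rw [← hρ s]; simp, fun _ => rfl⟩
      have hp : IsProper G f := by
        rw [proper_iff B]
        intro s
        refine ⟨(hce s).proper (c s).2.1, ?_⟩
        have := (hce s).root
        rw [hfx]
        exact fun h' => (c s).2.2.2 (this.symm.trans h')
      have hd : Distinguishes G x f := by
        rw [dist_iff B hinj f hch]
        refine ⟨fun s => (hce s).dist (c s).2.2.1, ?_⟩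
        rintro ⟨j, v⟩ ⟨j', w⟩ h'
        have hj : j = j' := hcls ⟨j, v⟩ ⟨j', w⟩ _ _ h'
        subst hj
        have h5 : h j v = h j w := by
          rw [← hc ⟨j, v⟩, ← hc ⟨j, w⟩]
          exact (colRel_eq _ _).2 ((hce _).symm.trans (h'.trans (hce ⟨j, w⟩)))
        rw [hh j h5]
      refine ⟨⟨f, hp, hd, hfx⟩, ?_⟩
      funext j v
      rw [← hc ⟨j, v⟩]
      exact (colRel_eq _ _).2 ((hbc f ⟨j, v⟩).trans (hce ⟨j, v⟩)))
    (by
      intro f g h j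
      exact Set.Subset.antisymm (hsub f g h j) (hsub g f (ColEquiv.symm h) j))
    (by
      intro f g h
      have hτ : ∀ j, ∃ τ : Equiv.Perm (C j), ∀ v, F f j v = F g j (τ v) := by
        intro j
        have hm : ∀ v, ∃ w, F g j w = F f j v := fun v => by
          have : F f j v ∈ Set.range (F g j) := h j ▸ ⟨v, rfl⟩
          exact this
        choose τ hτ using hm
        have hti : Function.Injective τ := by
          intro v w hvw
          have h6 : F f j v = F f j w := by rw [← hτ, ← hτ, hvw]
          have := ((dist_iff B hinj f.1 hch).1 f.2.2.1).2 ⟨j, v⟩ ⟨j, w⟩ ((hF f f j v w).1 h6)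
          exact Subtype.ext (congrArg ch this)
        exact ⟨Equiv.ofBijective τ (Finite.injective_iff_bijective.1 hti), fun v => (hτ v).symm⟩
      choose τ hτ using hτ
      obtain ⟨σ, hx, hc, _⟩ := equiv_of_perm B f.1 g.1 (by rw [f.2.2.2, g.2.2.2])
        (Equiv.sigmaCongrRight τ) (fun s => (hF f g s.1 s.2 (τ s.1 s.2)).1 (hτ s.1 s.2))
      exact ⟨σ, hx, hc⟩)
  unfold DChiCountI
  rw [main]
  refine Finset.prod_congr rfl fun j _ => ?_
  rw [Fintype.card_coe]
  congr 1
  exact XQ_card _ _ k i ⟨0, hk⟩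
end
end
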